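/- arXiv:math/9912220 — 5 statements merged into one kernel-verified Lean document; each statement's English description precedes it below -/
import Mathlib

section
/- Under the smallness conditions v < 1 and v·‖Ã‖ < d₀(1−v)²/4, let X be the solution of X = V(Ã+X) with ‖X‖ ≤ r_min and H := Ã + X. Then for every z ∈ ℂ with dist(z, σ(Ã)) ≤ d₀(1−v)/2, the operator M(z) fails to be boundedly invertible if and only if z belongs to the spectrum of H; in other words, the spectrum of the analytically continued transfer function M inside the set O(Ã,Γ) := { z : dist(z, σ(Ã)) ≤ d₀(1−v)/2 } equals σ(H). -/
open MeasureTheory ContinuousLinearMap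

/-- `X` solves the basic equation `X = V₁(Ã + X, Γ)` (with the Bochner integral
well defined). -/
def IsSolution {H : Type*} [NormedAddCommGroup H] [NormedSpace ℂ H] [CompleteSpace H]
    {Ω : Type*} [MeasurableSpace Ω] (μ : Measure Ω)
    (ζ : Ω → ℂ) (K : Ω → H →L[ℂ] H) (A X : H →L[ℂ] H) : Prop :=
  (∀ᵐ ω ∂μ, IsUnit (A + X - ζ ω • (1 : H →L[ℂ] H))) ∧
  Integrable (fun ω =>
    K ω ∘L ((A + X) ∘L Ring.inverse (A + X - ζ ω • (1 : H →L[ℂ] H)))) μ ∧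
  X = ∫ ω, K ω ∘L ((A + X) ∘L Ring.inverse (A + X - ζ ω • (1 : H →L[ℂ] H))) ∂μ

/-- The analytically continued transfer function
`M(z) = Ã - z + ∫ z/(z-ζ(ω)) K(ω) dμ(ω)`. -/
noncomputable def Mtr {H : Type*} [NormedAddCommGroup H] [NormedSpace ℂ H] [CompleteSpace H]
    {Ω : Type*} [MeasurableSpace Ω] (μ : Measure Ω)
    (ζ : Ω → ℂ) (K : Ω → H →L[ℂ] H) (A : H →L[ℂ] H) (z : ℂ) : H →L[ℂ] H :=
  A - z • (1 : H →L[ℂ] H) + ∫ ω, (z / (z - ζ ω)) • K ω ∂μ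

/-- Norm-below bound for `A - w` with `A` self-adjoint. -/
theorem selfAdjoint_bound_below {H : Type*} [NormedAddCommGroup H] [InnerProductSpace ℂ H]
    [CompleteSpace H] (A : H →L[ℂ] H) (hA : IsSelfAdjoint A) (w : ℂ)
    (hd : 0 < Metric.infDist w (spectrum ℂ A)) (x : H) :
    Metric.infDist w (spectrum ℂ A) * ‖x‖ ≤ ‖(A - w • (1 : H →L[ℂ] H)) x‖ := by
  set d := Metric.infDist w (spectrum ℂ A) with hdd
  have hN : IsStarNormal A := hA.isStarNormal
  have hne : ∀ t ∈ spectrum ℂ A, d ≤ ‖t - w‖ := by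
    intro t ht
    have := Metric.infDist_le_dist_of_mem (x := w) ht
    rwa [dist_comm, dist_eq_norm] at this
  have hne0 : ∀ t ∈ spectrum ℂ A, t - w ≠ 0 := fun t ht h0 => by
    have := hne t ht
    rw [h0, norm_zero] at this
    linarith
  have hc : ContinuousOn (fun t : ℂ => (t - w)⁻¹) (spectrum ℂ A) :=
    ContinuousOn.inv₀ (by fun_prop) hne0
  have hsub : A - w • (1 : H →L[ℂ] H) = cfc (fun t : ℂ => t - w) A := by
    rw [cfc_sub (a := A) (fun t : ℂ => t) (fun _ => w), cfc_id' ℂ A, cfc_const w A,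
      Algebra.algebraMap_eq_smul_one]
  have hmul : cfc (fun t : ℂ => (t - w)⁻¹) A * (A - w • (1 : H →L[ℂ] H)) = 1 := by
    rw [hsub, ← cfc_mul _ _ A hc (by fun_prop), ← cfc_one ℂ A]
    refine cfc_congr fun t ht => ?_
    simp [inv_mul_cancel₀ (hne0 t ht)]
  have hnorm : ‖cfc (fun t : ℂ => (t - w)⁻¹) A‖ ≤ d⁻¹ := by
    refine norm_cfc_le (by positivity) fun t ht => ?_
    rw [norm_inv]
    exact inv_anti₀ hd (hne t ht)
  have hx : cfc (fun t : ℂ => (t - w)⁻¹) A ((A - w • (1 : H →L[ℂ] H)) x) = x := by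
    have := congrArg (fun T : H →L[ℂ] H => T x) hmul
    simpa using this
  have h1 : ‖x‖ ≤ d⁻¹ * ‖(A - w • (1 : H →L[ℂ] H)) x‖ := by
    conv_lhs => rw [← hx]
    exact ContinuousLinearMap.le_of_opNorm_le _ hnorm _
  calc d * ‖x‖ ≤ d * (d⁻¹ * ‖(A - w • (1 : H →L[ℂ] H)) x‖) := by gcongr
    _ = _ := by rw [← mul_assoc, mul_inv_cancel₀ hd.ne', one_mul]

/-- The scalar estimate behind the invertibility of `W(z)`. -/
theorem scalar_bound (k d d₀ v a n r s : ℝ) (hk : 0 ≤ k) (hd₀ : 0 < d₀) (hd : d₀ ≤ d)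
    (hv0 : 0 ≤ v) (hv1 : v < 1) (ha : 0 ≤ a) (hn0 : 0 ≤ n) (hn : n ≤ a + d)
    (hr : d - d₀ * (1 - v) / 2 ≤ r) (hs : d - d₀ * (1 - v) / 2 ≤ s) :
    r⁻¹ * (k * (n * s⁻¹)) ≤ k / d * (4 * (a + d₀) / (d₀ * (1 + v) ^ 2)) := by
  have hdp : 0 < d := by linarith
  have hq : d * (1 + v) / 2 ≤ d - d₀ * (1 - v) / 2 := by nlinarith
  have hp : 0 < d * (1 + v) / 2 := by positivity
  have hr' : r⁻¹ ≤ (d * (1 + v) / 2)⁻¹ := inv_anti₀ hp (hq.trans hr)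
  have hs' : s⁻¹ ≤ (d * (1 + v) / 2)⁻¹ := inv_anti₀ hp (hq.trans hs)
  have hs0 : 0 ≤ s⁻¹ := inv_nonneg.2 (by linarith)
  have hn' : n ≤ (a + d₀) * (d / d₀) := by
    refine hn.trans ?_
    rw [← mul_div_assoc, le_div_iff₀ hd₀]
    nlinarith
  calc r⁻¹ * (k * (n * s⁻¹))
      ≤ (d * (1 + v) / 2)⁻¹ * (k * (((a + d₀) * (d / d₀)) * (d * (1 + v) / 2)⁻¹)) := by
        gcongr
    _ = k / d * (4 * (a + d₀) / (d₀ * (1 + v) ^ 2)) := by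
        field_simp
        ring

/-- The spectral identity (3.7) of Theorem `SpHalfVic`: inside the set
`O(Ã,Γ) = {z : dist(z, σ(Ã)) ≤ d₀(1-v)/2}` the transfer function `M(z)` fails to
be boundedly invertible exactly when `z ∈ σ(H)`, `H = Ã + X`. -/
theorem spectrum_transfer_eq_spectrum_H
    {H : Type*} [NormedAddCommGroup H] [InnerProductSpace ℂ H] [CompleteSpace H]
    {Ω : Type*} [MeasurableSpace Ω] (μ : Measure Ω)
    (ζ : Ω → ℂ) (hζ : Measurable ζ)
    (K : Ω → H →L[ℂ] H) (hK : Integrable K μ)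
    (A : H →L[ℂ] H) (hA : IsSelfAdjoint A)
    (d₀ : ℝ) (hd₀ : 0 < d₀)
    (hdist : ∀ᵐ ω ∂μ, d₀ ≤ Metric.infDist (ζ ω) (spectrum ℂ A))
    (hvInt : Integrable (fun ω => ‖K ω‖ / Metric.infDist (ζ ω) (spectrum ℂ A)) μ)
    (v : ℝ) (hv : v = ∫ ω, ‖K ω‖ / Metric.infDist (ζ ω) (spectrum ℂ A) ∂μ)
    (hv1 : v < 1) (hv2 : v * ‖A‖ < d₀ * (1 - v) ^ 2 / 4)
    (X : H →L[ℂ] H)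
    (hXnorm : ‖X‖ ≤ d₀ * (1 - v) / 2 -
      Real.sqrt (d₀ ^ 2 * (1 - v) ^ 2 / 4 - d₀ * v * ‖A‖))
    (hXsol : IsSolution μ ζ K A X) :
    ∀ z : ℂ, Metric.infDist z (spectrum ℂ A) ≤ d₀ * (1 - v) / 2 →
      (¬ IsUnit (Mtr μ ζ K A z) ↔ z ∈ spectrum ℂ (A + X)) := by
  intro z hz
  rcases subsingleton_or_nontrivial H with hsub | hnt
  · have hu : ∀ T : H →L[ℂ] H, IsUnit T := fun T => isUnit_of_subsingleton T
    exact iff_of_false (not_not.2 (hu _)) (not_not.2 (hu _))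
  obtain ⟨hunit, hint, hXeq⟩ := hXsol
  have hv0 : 0 ≤ v := by
    rw [hv]
    exact integral_nonneg fun ω => div_nonneg (norm_nonneg _) Metric.infDist_nonneg
  have hXn : ‖X‖ ≤ d₀ * (1 - v) / 2 := hXnorm.trans (sub_le_self _ (Real.sqrt_nonneg _))
  set B := A + X with hB
  set R : Ω → H →L[ℂ] H := fun ω => Ring.inverse (B - ζ ω • (1 : H →L[ℂ] H)) with hR
  set C : ℝ := 4 * (‖A‖ + d₀) / (d₀ * (1 + v) ^ 2) with hC
  -- distance from `z` to the contour
  have hzζ : ∀ᵐ ω ∂μ, Metric.infDist (ζ ω) (spectrum ℂ A) - d₀ * (1 - v) / 2 ≤ ‖z - ζ ω‖ := by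
    refine Filter.Eventually.of_forall fun ω => ?_
    have := Metric.infDist_le_infDist_add_dist (s := spectrum ℂ A) (x := ζ ω) (y := z)
    rw [dist_comm, dist_eq_norm] at this
    linarith
  have hδ : d₀ * (1 + v) / 2 = d₀ - d₀ * (1 - v) / 2 := by ring
  have hδ0 : 0 < d₀ * (1 + v) / 2 := by positivity
  have hζn : ∀ᵐ ω ∂μ, ‖ζ ω‖ ≤ ‖A‖ + Metric.infDist (ζ ω) (spectrum ℂ A) := by
    refine Filter.Eventually.of_forall fun ω => ?_
    obtain ⟨t, ht, hdt⟩ := (spectrum.isCompact (𝕜 := ℂ) A).exists_infDist_eq_dist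
      (spectrum.nonempty A) (ζ ω)
    have h1 : ‖t‖ ≤ ‖A‖ := spectrum.norm_le_norm_of_mem ht
    have h2 : ‖ζ ω‖ ≤ ‖t‖ + ‖ζ ω - t‖ := by
      simpa using norm_add_le t (ζ ω - t)
    rw [hdt, dist_eq_norm]
    linarith
  have hRn : ∀ᵐ ω ∂μ,
      ‖R ω‖ ≤ (Metric.infDist (ζ ω) (spectrum ℂ A) - d₀ * (1 - v) / 2)⁻¹ := by
    filter_upwards [hunit, hdist] with ω hω hd
    have hp : 0 < Metric.infDist (ζ ω) (spectrum ℂ A) - d₀ * (1 - v) / 2 := by linarith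
    refine ContinuousLinearMap.opNorm_le_bound _ (by positivity) fun y => ?_
    have hy : (B - ζ ω • (1 : H →L[ℂ] H)) (R ω y) = y := by
      have := congrArg (fun T : H →L[ℂ] H => T y) (Ring.mul_inverse_cancel _ hω)
      simpa [hR] using this
    have h1 := selfAdjoint_bound_below A hA (ζ ω) (hd₀.trans_le hd) (R ω y)
    have h2 : (A - ζ ω • (1 : H →L[ℂ] H)) (R ω y) = y - X (R ω y) := by
      have hAB : A - ζ ω • (1 : H →L[ℂ] H) = (B - ζ ω • (1 : H →L[ℂ] H)) - X := by
        rw [hB]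
        abel
      rw [hAB, _root_.sub_apply, hy]
    rw [h2] at h1
    have h3 : ‖X (R ω y)‖ ≤ d₀ * (1 - v) / 2 * ‖R ω y‖ :=
      ContinuousLinearMap.le_of_opNorm_le _ hXn _
    have h4 := norm_sub_le y (X (R ω y))
    rw [inv_mul_eq_div, le_div_iff₀ hp]
    linarith
  -- the operator `W(z) = 1 + F`
  set f : Ω → H →L[ℂ] H := fun ω => (z - ζ ω)⁻¹ • (K ω ∘L (B ∘L R ω) - K ω) with hf
  have hfeq : ∀ᵐ ω ∂μ, f ω = (z - ζ ω)⁻¹ • (K ω * (ζ ω • R ω)) := by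
    filter_upwards [hunit] with ω hω
    have h := Ring.mul_inverse_cancel _ hω
    have h' : B * R ω = 1 + ζ ω • R ω := by
      rw [sub_mul, smul_mul_assoc, one_mul] at h
      exact sub_eq_iff_eq_add.1 h
    have : K ω ∘L (B ∘L R ω) = K ω * (B * R ω) := rfl
    simp only [hf]
    rw [this, h', mul_add, mul_one, add_sub_cancel_left]
  have hbd : ∀ᵐ ω ∂μ, ‖f ω‖ ≤ ‖K ω‖ / Metric.infDist (ζ ω) (spectrum ℂ A) * C := by
    filter_upwards [hfeq, hzζ, hζn, hRn, hdist] with ω h1 h2 h3 h4 h5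
    rw [h1, norm_smul, norm_inv]
    have hp : 0 < Metric.infDist (ζ ω) (spectrum ℂ A) - d₀ * (1 - v) / 2 := by linarith
    calc ‖z - ζ ω‖⁻¹ * ‖K ω * (ζ ω • R ω)‖
        ≤ ‖z - ζ ω‖⁻¹ * (‖K ω‖ * (‖ζ ω‖ *
          (Metric.infDist (ζ ω) (spectrum ℂ A) - d₀ * (1 - v) / 2)⁻¹)) := by
          gcongr
          refine (norm_mul_le _ _).trans ?_
          rw [norm_smul]
          gcongr
      _ ≤ _ := scalar_bound _ _ _ _ _ _ _ _ (norm_nonneg _) hd₀ h5 hv0 hv1 (norm_nonneg _)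
          (norm_nonneg _) h3 h2 le_rfl
  have hfm : AEStronglyMeasurable f μ := by
    have h1 : Measurable fun ω => (z - ζ ω)⁻¹ := (measurable_const.sub hζ).inv
    exact h1.aestronglyMeasurable.smul (hint.sub hK).aestronglyMeasurable
  have hfi : Integrable f μ := (hvInt.mul_const C).mono' hfm hbd
  have hFn : ‖∫ ω, f ω ∂μ‖ < 1 := by
    have h1 : ‖∫ ω, f ω ∂μ‖ ≤ v * C := by
      refine (norm_integral_le_of_norm_le (hvInt.mul_const C) hbd).trans ?_
      rw [integral_mul_const, ← hv]
    refine h1.trans_lt ?_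
    rw [hC, ← mul_div_assoc, div_lt_one (by positivity)]
    nlinarith
  have hW : IsUnit (1 + ∫ ω, f ω ∂μ) := by
    have := isUnit_one_sub_of_norm_lt_one (x := -∫ ω, f ω ∂μ) (by rwa [norm_neg])
    rwa [sub_neg_eq_add] at this
  have hgi : Integrable (fun ω => f ω * (B - z • (1 : H →L[ℂ] H))) μ := hfi.mul_const _
  have hfac : Mtr μ ζ K A z = (1 + ∫ ω, f ω ∂μ) * (B - z • (1 : H →L[ℂ] H)) := by
    have hpt : ∀ᵐ ω ∂μ, (z / (z - ζ ω)) • K ω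
        = K ω ∘L (B ∘L R ω) + f ω * (B - z • (1 : H →L[ℂ] H)) := by
      filter_upwards [hunit, hzζ, hdist, hfeq] with ω hω h1 h2 h3
      have hne : z - ζ ω ≠ 0 := by
        rw [← norm_pos_iff]
        linarith
      have hr : B * R ω = 1 + ζ ω • R ω := by
        have h := Ring.mul_inverse_cancel _ hω
        rw [sub_mul, smul_mul_assoc, one_mul] at h
        exact sub_eq_iff_eq_add.1 h
      have hl : R ω * B = 1 + ζ ω • R ω := by
        have h := Ring.inverse_mul_cancel _ hω
        rw [mul_sub, mul_smul_comm, mul_one] at h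
        exact sub_eq_iff_eq_add.1 h
      have e : K ω ∘L (B ∘L R ω) = K ω * (B * R ω) := rfl
      have e2 : (z - ζ ω)⁻¹ • (K ω * (ζ ω • R ω)) * (B - z • (1 : H →L[ℂ] H))
          = (z - ζ ω)⁻¹ • (ζ ω • (K ω * (1 + ζ ω • R ω - z • R ω))) := by
        rw [← hl]
        simp only [mul_sub, mul_smul_comm, smul_mul_assoc, mul_one, mul_assoc, smul_sub]
        match_scalars <;> ring
      rw [h3, e, e2, hr]
      simp only [mul_sub, mul_add, mul_smul_comm, mul_one]
      match_scalars
      · field_simp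
        ring
      · field_simp
        ring
    rw [Mtr, integral_congr_ae hpt, integral_add hint hgi, ← hXeq,
      integral_mul_const_of_integrable hfi, add_mul, one_mul]
    simp only [hB]
    abel
  rw [hfac, spectrum.mem_iff, not_iff_not, Algebra.algebraMap_eq_smul_one, ← IsUnit.neg_iff (z • _ - B), neg_sub]
  obtain ⟨u, hu⟩ := hW
  rw [← hu, Units.isUnit_units_mul]
end

section
/- Under the smallness conditions v < 1 and v·‖Ã‖ < d₀(1−v)²/4, let X be the solution of X = V(Ã+X) with ‖X‖ ≤ r_min and H := Ã + X. Then for every z ∈ ℂ with dist(z, σ(Ã)) ≤ d₀(1−v)/2 and every u ∈ H₁ one has M(z)u = 0 if and only if H u = z u; i.e. the kernel of M(z) coincides with the eigenspace ker(H − z). -/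
open MeasureTheory ContinuousLinearMap

/-- Lower bound for `A - ζ` for self-adjoint `A`. -/
lemma lower_bound_sub {H : Type*} [NormedAddCommGroup H] [InnerProductSpace ℂ H] [CompleteSpace H]
    (A : H →L[ℂ] H) (hA : IsSelfAdjoint A) (ζ : ℂ)
    (hδ : 0 < Metric.infDist ζ (spectrum ℂ A)) (x : H) :
    Metric.infDist ζ (spectrum ℂ A) * ‖x‖ ≤ ‖(A - ζ • (1 : H →L[ℂ] H)) x‖ := by
  have hn : IsStarNormal A := hA.isStarNormal
  set δ := Metric.infDist ζ (spectrum ℂ A) with hδd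
  have hle : ∀ y ∈ spectrum ℂ A, δ ≤ ‖y - ζ‖ := by
    intro y hy
    have := Metric.infDist_le_dist_of_mem (x := ζ) hy
    rwa [dist_comm, dist_eq_norm] at this
  have hne : ∀ y ∈ spectrum ℂ A, y - ζ ≠ 0 := by
    intro y hy h0
    have := hle y hy
    rw [h0, norm_zero] at this
    linarith
  have hc : ContinuousOn (fun y : ℂ => (y - ζ)⁻¹) (spectrum ℂ A) :=
    ContinuousOn.inv₀ (by fun_prop) hne
  have hB : ‖cfc (fun y : ℂ => (y - ζ)⁻¹) A‖ ≤ δ⁻¹ := by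
    apply norm_cfc_le (by positivity)
    intro y hy
    rw [norm_inv]
    exact inv_anti₀ hδ (hle y hy)
  have hsub : cfc (fun y : ℂ => y - ζ) A = A - ζ • (1 : H →L[ℂ] H) := by
    rw [cfc_sub (fun y : ℂ => y) (fun _ => ζ) A, cfc_id' ℂ A, cfc_const ζ A,
      Algebra.algebraMap_eq_smul_one]
  have hmul : cfc (fun y : ℂ => (y - ζ)⁻¹) A * (A - ζ • (1 : H →L[ℂ] H)) = 1 := by
    rw [← hsub, ← cfc_mul _ _ A hc (by fun_prop), ← cfc_one ℂ A]
    apply cfc_congr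
    intro y hy
    exact inv_mul_cancel₀ (hne y hy)
  have hx : x = cfc (fun y : ℂ => (y - ζ)⁻¹) A ((A - ζ • (1 : H →L[ℂ] H)) x) := by
    rw [← mul_apply_eq_comp, hmul]; rfl
  have h1 : ‖x‖ ≤ δ⁻¹ * ‖(A - ζ • (1 : H →L[ℂ] H)) x‖ := by
    conv_lhs => rw [hx]
    exact (le_opNorm _ _).trans (by gcongr)
  rwa [inv_mul_eq_div, le_div_iff₀ hδ, mul_comm] at h1

/-- Pointwise scalar estimate. -/
lemma scalar_est (d₀ c a δ : ℝ) (hc : 0 ≤ c) (hcd : c < d₀) (ha : 0 ≤ a) (hδ : d₀ ≤ δ) :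
    (1 + (a + c) / (δ - c)) * (1 / (δ - c)) ≤ d₀ * (d₀ + a) / (d₀ - c) ^ 2 * (1 / δ) := by
  have h1 : 0 < d₀ - c := by linarith
  have h2 : 0 < δ - c := by linarith
  have h3 : 0 < δ := by linarith
  have e : (1 + (a + c) / (δ - c)) * (1 / (δ - c)) =
      (δ / (δ - c)) * ((δ + a) / (δ - c)) * (1 / δ) := by
    field_simp
    ring
  have e2 : d₀ * (d₀ + a) / (d₀ - c) ^ 2 = (d₀ / (d₀ - c)) * ((d₀ + a) / (d₀ - c)) := by
    field_simp
  rw [e, e2]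
  have i1 : δ / (δ - c) ≤ d₀ / (d₀ - c) := by
    rw [div_le_div_iff₀ h2 h1]; nlinarith
  have i2 : (δ + a) / (δ - c) ≤ (d₀ + a) / (d₀ - c) := by
    rw [div_le_div_iff₀ h2 h1]; nlinarith
  have : 0 < d₀ := by linarith
  gcongr

/-- Pointwise operator estimate. -/
lemma point_est {H : Type*} [NormedAddCommGroup H] [InnerProductSpace ℂ H] [CompleteSpace H]
    [Nontrivial H]
    (A X L : H →L[ℂ] H) (hA : IsSelfAdjoint A) (ζ z : ℂ) (d₀ c : ℝ) (hc : 0 ≤ c) (hcd : c < d₀)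
    (hδ : d₀ ≤ Metric.infDist ζ (spectrum ℂ A)) (hz : Metric.infDist z (spectrum ℂ A) ≤ c)
    (hX : ‖X‖ ≤ c) (hU : IsUnit (A + X - ζ • (1 : H →L[ℂ] H))) (u : H) :
    ‖((z / (z - ζ)) • L) u -
      (L ∘L ((A + X) ∘L Ring.inverse (A + X - ζ • (1 : H →L[ℂ] H)))) u‖ ≤
    d₀ * (d₀ + ‖A‖) / (d₀ - c) ^ 2 * ‖(A + X) u - z • u‖ *
      (‖L‖ / Metric.infDist ζ (spectrum ℂ A)) := by
  set δ := Metric.infDist ζ (spectrum ℂ A) with hδd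
  set w := (A + X) u - z • u with hw
  set R := Ring.inverse (A + X - ζ • (1 : H →L[ℂ] H)) with hR
  have h2 : 0 < δ - c := by linarith
  have hzζ : δ - c ≤ ‖z - ζ‖ := by
    have := Metric.infDist_le_infDist_add_dist (s := spectrum ℂ A) (x := ζ) (y := z)
    rw [dist_comm, dist_eq_norm] at this
    linarith
  have hz0 : z - ζ ≠ 0 := by
    intro h; rw [h, norm_zero] at hzζ; linarith
  have hznorm : ‖z‖ ≤ ‖A‖ + c := by
    obtain ⟨y, hy, hyd⟩ := (spectrum.isCompact (𝕜 := ℂ) A).exists_infDist_eq_dist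
      (spectrum.nonempty A) z
    have hy' : ‖y‖ ≤ ‖A‖ := spectrum.norm_le_norm_of_mem hy
    rw [hyd, dist_eq_norm] at hz
    calc ‖z‖ = ‖(z - y) + y‖ := by simp
      _ ≤ ‖z - y‖ + ‖y‖ := norm_add_le _ _
      _ ≤ ‖A‖ + c := by linarith
  have hRl : ∀ x, R ((A + X) x - ζ • x) = x := by
    intro x
    have := congrArg (fun T : H →L[ℂ] H => T x) (Ring.inverse_mul_cancel _ hU)
    simpa using this
  have hRr : ∀ x, (A + X) (R x) - ζ • R x = x := by
    intro x
    have := congrArg (fun T : H →L[ℂ] H => T x) (Ring.mul_inverse_cancel _ hU)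
    simpa using this
  have hRn : ∀ x, ‖R x‖ ≤ 1 / (δ - c) * ‖x‖ := by
    intro x
    have h := lower_bound_sub A hA ζ (by linarith) (R x)
    have e : (A - ζ • (1 : H →L[ℂ] H)) (R x) = x - X (R x) := by
      have := hRr x
      simp only [add_apply] at this
      have h1 : (A - ζ • (1 : H →L[ℂ] H)) (R x) = A (R x) - ζ • R x := rfl
      rw [h1, eq_sub_iff_add_eq]
      refine Eq.trans ?_ this
      abel
    rw [e] at h
    have h' : ‖x - X (R x)‖ ≤ ‖x‖ + c * ‖R x‖ :=
      (norm_sub_le _ _).trans (by gcongr; exact (le_opNorm _ _).trans (by gcongr))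
    rw [one_div, inv_mul_eq_div, le_div_iff₀ h2]
    nlinarith
  have key : ((z / (z - ζ)) • L) u - (L ∘L ((A + X) ∘L R)) u = (ζ / (z - ζ)) • L (R w) := by
    have hYR : (A + X) (R u) = u + ζ • R u := by
      rw [← sub_eq_iff_eq_add]; exact hRr u
    have hRw : R w = u + (ζ - z) • R u := by
      have : w = ((A + X) u - ζ • u) + (ζ - z) • u := by rw [hw, sub_smul]; abel
      rw [this, map_add, hRl, map_smul]
    simp only [smul_apply, comp_apply]
    rw [hYR, hRw]
    simp only [map_add, map_smul, smul_add, smul_smul]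
    have c1 : z / (z - ζ) = ζ / (z - ζ) + 1 := by field_simp; ring
    have c2 : ζ / (z - ζ) * (ζ - z) = - ζ := by field_simp; ring
    rw [c1, c2]
    module
  rw [key, norm_smul, norm_div]
  have hfrac : ‖ζ‖ / ‖z - ζ‖ ≤ 1 + (‖A‖ + c) / (δ - c) := by
    have hp : 0 < ‖z - ζ‖ := by linarith
    have : ‖ζ‖ ≤ ‖z - ζ‖ + ‖z‖ := by
      calc ‖ζ‖ = ‖z - (z - ζ)‖ := by simp
        _ ≤ _ := (norm_sub_le _ _).trans (by linarith)
    calc ‖ζ‖ / ‖z - ζ‖ ≤ (‖z - ζ‖ + ‖z‖) / ‖z - ζ‖ := by gcongr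
      _ = 1 + ‖z‖ / ‖z - ζ‖ := by field_simp
      _ ≤ _ := by gcongr
  have hs := scalar_est d₀ c ‖A‖ δ hc hcd (norm_nonneg _) hδ
  calc ‖ζ‖ / ‖z - ζ‖ * ‖L (R w)‖
      ≤ (1 + (‖A‖ + c) / (δ - c)) * (‖L‖ * (1 / (δ - c) * ‖w‖)) := by
        gcongr
        exact (le_opNorm _ _).trans (by gcongr; exact hRn w)
    _ = ((1 + (‖A‖ + c) / (δ - c)) * (1 / (δ - c))) * (‖L‖ * ‖w‖) := by ring
    _ ≤ (d₀ * (d₀ + ‖A‖) / (d₀ - c) ^ 2 * (1 / δ)) * (‖L‖ * ‖w‖) := by gcongr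
    _ = _ := by ring

/-- Point-spectrum part of Theorem `SpHalfVic`: for `z` in the set
`O(Ã,Γ) = {z : dist(z, σ(Ã)) ≤ d₀(1-v)/2}` the kernel of the transfer function
`M(z)` coincides with the eigenspace `ker(H - z)`, `H = Ã + X`. -/
theorem ker_transfer_eq_eigenspace
    {H : Type*} [NormedAddCommGroup H] [InnerProductSpace ℂ H] [CompleteSpace H]
    {Ω : Type*} [MeasurableSpace Ω] (μ : Measure Ω)
    (ζ : Ω → ℂ) (hζ : Measurable ζ)
    (K : Ω → H →L[ℂ] H) (hK : Integrable K μ)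
    (A : H →L[ℂ] H) (hA : IsSelfAdjoint A)
    (d₀ : ℝ) (hd₀ : 0 < d₀)
    (hdist : ∀ᵐ ω ∂μ, d₀ ≤ Metric.infDist (ζ ω) (spectrum ℂ A))
    (hvInt : Integrable (fun ω => ‖K ω‖ / Metric.infDist (ζ ω) (spectrum ℂ A)) μ)
    (v : ℝ) (hv : v = ∫ ω, ‖K ω‖ / Metric.infDist (ζ ω) (spectrum ℂ A) ∂μ)
    (hv1 : v < 1) (hv2 : v * ‖A‖ < d₀ * (1 - v) ^ 2 / 4)
    (X : H →L[ℂ] H)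
    (hXnorm : ‖X‖ ≤ d₀ * (1 - v) / 2 -
      Real.sqrt (d₀ ^ 2 * (1 - v) ^ 2 / 4 - d₀ * v * ‖A‖))
    (hXsol : IsSolution μ ζ K A X) :
    ∀ z : ℂ, Metric.infDist z (spectrum ℂ A) ≤ d₀ * (1 - v) / 2 →
      ∀ u : H, Mtr μ ζ K A z u = 0 ↔ (A + X) u = z • u := by
  intro z hz u
  rcases subsingleton_or_nontrivial H with hS | hN
  · exact iff_of_true (Subsingleton.elim _ _) (Subsingleton.elim _ _)
  obtain ⟨hU, hI, hXeq⟩ := hXsol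
  have hv0 : 0 ≤ v := by
    rw [hv]; exact integral_nonneg fun ω => div_nonneg (norm_nonneg _) Metric.infDist_nonneg
  set c := d₀ * (1 - v) / 2 with hcdef
  have hc : 0 ≤ c := by
    have : 0 < 1 - v := by linarith
    positivity
  have hcd : c < d₀ := by rw [hcdef]; nlinarith
  have hX : ‖X‖ ≤ c := hXnorm.trans (by linarith [Real.sqrt_nonneg (d₀ ^ 2 * (1 - v) ^ 2 / 4 - d₀ * v * ‖A‖)])
  have hlow : ∀ᵐ ω ∂μ, d₀ - c ≤ ‖z - ζ ω‖ := by
    filter_upwards [hdist] with ω hω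
    have := Metric.infDist_le_infDist_add_dist (s := spectrum ℂ A) (x := ζ ω) (y := z)
    rw [dist_comm, dist_eq_norm] at this
    linarith
  have hKI : Integrable (fun ω => (z / (z - ζ ω)) • K ω) μ := by
    refine hK.bdd_smul (φ := fun ω => z / (z - ζ ω)) (‖z‖ / (d₀ - c)) ?_ ?_
    · exact (measurable_const.div (measurable_const.sub hζ)).aestronglyMeasurable
    · filter_upwards [hlow] with ω hω
      rw [norm_div]
      have : 0 < d₀ - c := by linarith
      gcongr
  set w := (A + X) u - z • u with hw
  have hM : Mtr μ ζ K A z u = w + ∫ ω, (((z / (z - ζ ω)) • K ω) u -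
      (K ω ∘L ((A + X) ∘L Ring.inverse (A + X - ζ ω • (1 : H →L[ℂ] H)))) u) ∂μ := by
    rw [integral_sub (hKI.apply_continuousLinearMap u) (hI.apply_continuousLinearMap u),
      ← ContinuousLinearMap.integral_apply hKI, ← ContinuousLinearMap.integral_apply hI, ← hXeq]
    have h1 : (1 : H →L[ℂ] H) u = u := rfl
    simp only [Mtr, hw, add_apply, sub_apply, smul_apply, h1]
    abel
  set e := ∫ ω, (((z / (z - ζ ω)) • K ω) u -
      (K ω ∘L ((A + X) ∘L Ring.inverse (A + X - ζ ω • (1 : H →L[ℂ] H)))) u) ∂μ with he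
  set C := d₀ * (d₀ + ‖A‖) / (d₀ - c) ^ 2 with hC
  have hen : ‖e‖ ≤ C * ‖w‖ * v := by
    rw [hv, ← integral_const_mul]
    apply norm_integral_le_of_norm_le (hvInt.const_mul _)
    filter_upwards [hdist, hU] with ω h1 h2
    exact point_est A X (K ω) hA (ζ ω) z d₀ c hc hcd h1 hz hX h2 u
  have hCv : C * v < 1 := by
    have hp : 0 < d₀ - c := by linarith
    rw [hC, div_mul_eq_mul_div, div_lt_one (by positivity), hcdef]
    nlinarith
  rw [hM, ← sub_eq_zero (a := (A + X) u), ← hw]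
  constructor
  · intro h
    have h1 : ‖w‖ = ‖e‖ := by rw [eq_neg_of_add_eq_zero_left h, norm_neg]
    by_contra hne
    have : 0 < ‖w‖ := norm_pos_iff.mpr hne
    nlinarith
  · intro h
    rw [h, norm_zero, mul_zero, zero_mul] at hen
    rw [h, norm_le_zero_iff.mp hen, add_zero]
end

section
/- Under the smallness conditions v < 1 and v·‖Ã‖ < d₀(1−v)²/4, let X, X⁻, H := Ã + X, H⁻ := Ã + X⁻ and Ω° be as in Theorem 'MHOmega'. Let c ∈ ℂ and R > 0 be such that the closed disk { z : |z−c| ≤ R } is contained in O(Ã,Γ) := { z : dist(z, σ(Ã)) ≤ d₀(1−v)/2 } and the spectrum of H is contained in the open disk { z : |z−c| < R }. Then −(1/(2πi)) ∮_{|z−c|=R} M(z)⁻¹ dz = (I + Ω°)⁻¹, where M(z)⁻¹ denotes the (existing) bounded inverse of the transfer function M(z) for z on the circle and the integral is the contour integral over the positively oriented circle. -/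
open MeasureTheory ContinuousLinearMap

/-- The operator `Ω = ∫ ζ(ω) (Hl - ζ(ω))⁻¹ K(ω) (Hr - ζ(ω))⁻¹ dμ(ω)` of (4.8neu). -/
noncomputable def OmegaOp {H : Type*} [NormedAddCommGroup H] [NormedSpace ℂ H] [CompleteSpace H]
    {Ω : Type*} [MeasurableSpace Ω] (μ : Measure Ω)
    (ζ : Ω → ℂ) (K : Ω → H →L[ℂ] H) (Hl Hr : H →L[ℂ] H) : H →L[ℂ] H :=
  ∫ ω, ζ ω • (Ring.inverse (Hl - ζ ω • (1 : H →L[ℂ] H)) ∘L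
    (K ω ∘L Ring.inverse (Hr - ζ ω • (1 : H →L[ℂ] H)))) ∂μ



section aux
variable {E : Type*} [NormedRing E] [NormedAlgebra ℂ E] [CompleteSpace E]

lemma aux_resolvent_circle (a : E) (c : ℂ) (R : ℝ) (hR : 0 < R)
    (hs : spectrum ℂ a ⊆ Metric.ball c R) :
    (∮ z in C(c, R), resolvent a z) = (2 * (Real.pi : ℂ) * Complex.I) • (1 : E) := by
  have hmem : ∀ z, z ∉ Metric.ball c R → z ∈ resolventSet ℂ a := fun z hz => by
    by_contra h
    exact hz (hs h)
  have hd : ∀ z, z ∉ Metric.ball c R → DifferentiableAt ℂ (resolvent a) z := fun z hz =>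
    (spectrum.hasDerivAt_resolvent_const_left (hmem z hz)).differentiableAt
  let f : ℂ → E := fun z => (a - algebraMap ℂ E c) * resolvent a z
  have hfd : ∀ z, z ∉ Metric.ball c R → DifferentiableAt ℂ f z := fun z hz =>
    (hd z hz).const_mul _
  have key : ∀ r, R ≤ r → (∮ z in C(c, r), (z - c)⁻¹ • f z) = ∮ z in C(c, R), (z - c)⁻¹ • f z := by
    intro r hr
    refine Complex.circleIntegral_sub_center_inv_smul_eq_of_differentiable_on_annulus_off_countable
      hR hr Set.countable_empty ?_ ?_
    · intro z hz
      exact (hfd z hz.2).continuousAt.continuousWithinAt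
    · intro z hz
      exact hfd z (fun h => hz.1.2 (Metric.ball_subset_closedBall h))
  have hzero : (∮ z in C(c, R), (z - c)⁻¹ • f z) = 0 := by
    have ht : Filter.Tendsto f (Bornology.cobounded ℂ) (nhds 0) := by
      have := (spectrum.resolvent_tendsto_cobounded (𝕜 := ℂ) a).const_mul (a - algebraMap ℂ E c)
      simpa using this
    have : ∀ ε > 0, ‖∮ z in C(c, R), (z - c)⁻¹ • f z‖ ≤ 2 * Real.pi * ε := by
      intro ε hε
      have h1 := (Metric.tendsto_nhds.1 ht) ε hε
      rw [Filter.HasBasis.eventually_iff (Metric.hasBasis_cobounded_compl_closedBall c)] at h1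
      obtain ⟨r, -, hr⟩ := h1
      set ρ := max R (r + 1)
      have hρ : 0 < ρ := lt_of_lt_of_le hR (le_max_left _ _)
      rw [← key ρ (le_max_left _ _)]
      refine (circleIntegral.norm_integral_le_of_norm_le_const (C := ρ⁻¹ * ε) hρ.le ?_).trans ?_
      · intro z hz
        have hz' : ‖z - c‖ = ρ := by simpa [dist_eq_norm] using hz
        rw [norm_smul, norm_inv, hz']
        have : dist (f z) 0 < ε := hr (by
          simp only [Set.mem_compl_iff, Metric.mem_closedBall, dist_eq_norm, hz', not_le]
          exact lt_of_lt_of_le (lt_add_one r) (le_max_right _ _))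
        rw [dist_zero_right] at this
        gcongr
      · apply le_of_eq; field_simp
    by_contra hne
    have hp : 0 < ‖∮ z in C(c, R), (z - c)⁻¹ • f z‖ := norm_pos_iff.2 hne
    have := this (‖∮ z in C(c, R), (z - c)⁻¹ • f z‖ / (4 * Real.pi)) (by positivity)
    have h2 : 2 * Real.pi * (‖∮ z in C(c, R), (z - c)⁻¹ • f z‖ / (4 * Real.pi))
      = ‖∮ z in C(c, R), (z - c)⁻¹ • f z‖ / 2 := by field_simp; ring
    linarith
  have hcont : ContinuousOn (fun z : ℂ => (z - c)⁻¹) (Metric.sphere c R) := by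
    apply ContinuousOn.inv₀ (by fun_prop)
    intro z hz h
    rw [sub_eq_zero] at h
    rw [h] at hz; simp at hz; exact hR.ne hz
  have hns : ∀ z ∈ Metric.sphere c R, z ∉ Metric.ball c R := fun z hz h => by
    rw [mem_sphere_iff_norm] at hz
    rw [Metric.mem_ball, dist_eq_norm] at h
    linarith
  have heq : Set.EqOn (resolvent a) (fun z => (z - c)⁻¹ • (1 : E) + (z - c)⁻¹ • f z)
      (Metric.sphere c R) := by
    intro z hz
    have hu := hmem z (hns z hz)
    rw [spectrum.mem_resolventSet_iff] at hu
    have hne : z - c ≠ 0 := fun h => by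
      rw [sub_eq_zero] at h
      rw [h] at hz; simp at hz; exact hR.ne hz
    simp only [f]
    rw [← smul_add, eq_inv_smul_iff₀ hne, resolvent]
    have h1 := Ring.mul_inverse_cancel _ hu
    have : (z - c) • Ring.inverse (algebraMap ℂ E z - a)
      = (algebraMap ℂ E z - a) * Ring.inverse (algebraMap ℂ E z - a) +
        (a - algebraMap ℂ E c) * Ring.inverse (algebraMap ℂ E z - a) := by
      rw [Algebra.smul_def, map_sub]; noncomm_ring
    rw [this, h1]
  rw [circleIntegral.integral_congr hR.le heq, circleIntegral.integral_add, hzero, add_zero,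
    circleIntegral.integral_smul_const, circleIntegral.integral_sub_center_inv c hR.ne']
  · exact ContinuousOn.circleIntegrable hR.le (hcont.smul continuousOn_const)
  · refine ContinuousOn.circleIntegrable hR.le (hcont.smul ?_)
    intro z hz
    exact (hfd z (hns z hz)).continuousAt.continuousWithinAt

lemma aux_diff {Ω : Type*} [MeasurableSpace Ω] {μ : Measure Ω} {ζ : Ω → ℂ} (hζ : Measurable ζ)
    {Y : Ω → E} (hY : AEStronglyMeasurable Y μ) (z₀ : ℂ) (δ : ℝ) (hδ : 0 < δ)
    (hz : ∀ᵐ ω ∂μ, δ ≤ ‖z₀ - ζ ω‖)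
    (hint : Integrable (fun ω => (z₀ - ζ ω)⁻¹ • Y ω) μ) :
    DifferentiableAt ℂ (fun z => ∫ ω, (z - ζ ω)⁻¹ • Y ω ∂μ) z₀ := by
  have hm : ∀ z, AEStronglyMeasurable (fun ω => (z - ζ ω)⁻¹) μ := fun z =>
    ((measurable_const.sub hζ).inv).aestronglyMeasurable
  have hlow : ∀ᵐ ω ∂μ, ∀ z ∈ Metric.ball z₀ (δ / 2), ‖z₀ - ζ ω‖ / 2 ≤ ‖z - ζ ω‖ ∧ 0 < ‖z - ζ ω‖ := by
    filter_upwards [hz] with ω hω z hzb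
    have h1 : ‖z₀ - ζ ω‖ ≤ ‖z - ζ ω‖ + ‖z - z₀‖ := by
      have := norm_sub_le (z - ζ ω) (z - z₀)
      simpa using this
    rw [Metric.mem_ball, dist_eq_norm] at hzb
    constructor <;> linarith
  refine (hasDerivAt_integral_of_dominated_loc_of_deriv_le
    (F := fun z ω => (z - ζ ω)⁻¹ • Y ω)
    (F' := fun z ω => (-((z - ζ ω)⁻¹ ^ 2)) • Y ω)
    (bound := fun ω => 4 / δ * ‖(z₀ - ζ ω)⁻¹ • Y ω‖) (Metric.ball_mem_nhds z₀ (half_pos hδ))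
    (Filter.Eventually.of_forall fun z => (hm z).smul hY) hint (((hm z₀).pow 2).neg.smul hY)
    ?_ (hint.norm.const_mul _) ?_).2.differentiableAt
  · filter_upwards [hlow, hz] with ω hω hzω z hzb
    obtain ⟨h1, h2⟩ := hω z hzb
    rw [norm_smul, norm_smul, norm_neg, norm_pow, norm_inv, norm_inv, ← mul_assoc]
    gcongr
    have h3 : 0 < ‖z₀ - ζ ω‖ := by linarith
    have h4 : ‖z - ζ ω‖⁻¹ ≤ 2 * ‖z₀ - ζ ω‖⁻¹ := by
      rw [inv_le_comm₀ h2 (by positivity)]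
      have : (2 * ‖z₀ - ζ ω‖⁻¹)⁻¹ = ‖z₀ - ζ ω‖ / 2 := by field_simp
      rw [this]; exact h1
    have h5 : ‖z₀ - ζ ω‖⁻¹ ≤ δ⁻¹ := inv_anti₀ hδ hzω
    calc ‖z - ζ ω‖⁻¹ ^ 2 ≤ (2 * ‖z₀ - ζ ω‖⁻¹) ^ 2 := by gcongr
      _ = 4 * ‖z₀ - ζ ω‖⁻¹ * ‖z₀ - ζ ω‖⁻¹ := by ring
      _ ≤ 4 * δ⁻¹ * ‖z₀ - ζ ω‖⁻¹ := by gcongr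
      _ = _ := by ring
  · filter_upwards [hlow] with ω hω z hzb
    have h2 : z - ζ ω ≠ 0 := norm_pos_iff.1 (hω z hzb).2
    have h := (((hasDerivAt_id z).sub_const (ζ ω)).inv h2).smul_const (Y ω)
    convert h using 2 <;> simp [neg_div]


lemma aux_main {Ω : Type*} [MeasurableSpace Ω] {μ : Measure Ω} {ζ : Ω → ℂ} (hζ : Measurable ζ)
    {K : Ω → E} (hK : Integrable K μ) (A X Y : E) (RH RL : Ω → E)
    (hRHm : AEStronglyMeasurable RH μ) (hRLm : AEStronglyMeasurable RL μ)
    (hRH : ∀ᵐ ω ∂μ, RH ω * (A + X - ζ ω • 1) = 1)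
    (hRL : ∀ᵐ ω ∂μ, (A + Y - ζ ω • 1) * RL ω = 1)
    (hRH' : ∀ᵐ ω ∂μ, (A + X - ζ ω • 1) * RH ω = 1)
    (hRL' : ∀ᵐ ω ∂μ, RL ω * (A + Y - ζ ω • 1) = 1)
    (hXi : Integrable (fun ω => K ω * ((A + X) * RH ω)) μ)
    (hX : X = ∫ ω, K ω * ((A + X) * RH ω) ∂μ)
    (hYi : Integrable (fun ω => RL ω * (A + Y) * K ω) μ)
    (hY : Y = ∫ ω, RL ω * (A + Y) * K ω ∂μ)
    (g h : Ω → ℝ) (C : ℝ) (hC : 0 < C)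
    (hgC : ∀ᵐ ω ∂μ, 0 ≤ g ω ∧ g ω ≤ C)
    (hgH : ∀ᵐ ω ∂μ, ‖RH ω‖ ≤ g ω) (hgL : ∀ᵐ ω ∂μ, ‖RL ω‖ ≤ g ω)
    (c : ℂ) (R : ℝ) (hR : 0 < R)
    (hgz : ∀ z ∈ Metric.closedBall c R, ∀ᵐ ω ∂μ, z - ζ ω ≠ 0 ∧ ‖(z - ζ ω)⁻¹‖ ≤ g ω)
    (hh : Integrable h μ) (hgh : ∀ᵐ ω ∂μ, ‖ζ ω‖ * g ω ^ 2 * ‖K ω‖ ≤ h ω)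
    (hh1 : ∫ ω, h ω ∂μ < 1)
    (hspec : spectrum ℂ (A + X) ⊆ Metric.ball c R) :
    IsUnit (1 + ∫ ω, ζ ω • (RL ω * (K ω * RH ω)) ∂μ) ∧
    (-(1 / (2 * (Real.pi : ℂ) * Complex.I))) •
        (∮ z in C(c, R), Ring.inverse (A - z • 1 + ∫ ω, (z / (z - ζ ω)) • K ω ∂μ)) =
      Ring.inverse (1 + ∫ ω, ζ ω • (RL ω * (K ω * RH ω)) ∂μ) := by
  have hzm : ∀ z : ℂ, AEStronglyMeasurable (fun ω => (z - ζ ω)⁻¹) μ := fun z =>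
    ((measurable_const.sub hζ).inv).aestronglyMeasurable
  have hζm : AEStronglyMeasurable ζ μ := hζ.aestronglyMeasurable
  have hKm := hK.aestronglyMeasurable
  have hb1 : ∀ᵐ ω ∂μ, g ω * ‖ζ ω • (K ω * RH ω)‖ ≤ h ω := by
    filter_upwards [hgC, hgH, hgh] with ω h1 h2 h3
    refine le_trans ?_ h3
    rw [norm_smul]
    calc g ω * (‖ζ ω‖ * ‖K ω * RH ω‖) ≤ g ω * (‖ζ ω‖ * (‖K ω‖ * g ω)) := by
          have := h1.1
          gcongr
          exact (norm_mul_le _ _).trans (by gcongr)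
      _ = _ := by ring
  have hb2 : ∀ᵐ ω ∂μ, g ω * ‖ζ ω • (RL ω * K ω)‖ ≤ h ω := by
    filter_upwards [hgC, hgL, hgh] with ω h1 h2 h3
    refine le_trans ?_ h3
    rw [norm_smul]
    calc g ω * (‖ζ ω‖ * ‖RL ω * K ω‖) ≤ g ω * (‖ζ ω‖ * (g ω * ‖K ω‖)) := by
          have := h1.1
          gcongr
          exact (norm_mul_le _ _).trans (by gcongr)
      _ = _ := by ring
  have hb3 : ∀ᵐ ω ∂μ, ‖ζ ω • (RL ω * (K ω * RH ω))‖ ≤ h ω := by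
    filter_upwards [hgC, hgL, hb1] with ω h1 h2 h3
    refine le_trans ?_ h3
    rw [norm_smul, norm_smul]
    calc ‖ζ ω‖ * ‖RL ω * (K ω * RH ω)‖ ≤ ‖ζ ω‖ * (g ω * ‖K ω * RH ω‖) := by
          have := h1.1
          gcongr
          exact (norm_mul_le _ _).trans (by gcongr)
      _ = _ := by ring
  have hm1 : AEStronglyMeasurable (fun ω => ζ ω • (K ω * RH ω)) μ := hζm.smul (hKm.mul hRHm)
  have hm2 : AEStronglyMeasurable (fun ω => ζ ω • (RL ω * K ω)) μ := hζm.smul (hRLm.mul hKm)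
  have hm3 : AEStronglyMeasurable (fun ω => ζ ω • (RL ω * (K ω * RH ω))) μ :=
    hζm.smul (hRLm.mul (hKm.mul hRHm))
  have hΩi : Integrable (fun ω => ζ ω • (RL ω * (K ω * RH ω))) μ := hh.mono' hm3 hb3
  have hsm : ∀ S : E, ‖S‖ < 1 → IsUnit (1 + S) := fun S hS => by
    have := isUnit_one_sub_of_norm_lt_one (x := -S) (by simpa using hS)
    simpa using this
  set Om := ∫ ω, ζ ω • (RL ω * (K ω * RH ω)) ∂μ with hOm
  have hOmu : IsUnit (1 + Om) :=
    hsm _ ((norm_integral_le_of_norm_le hh hb3).trans_lt hh1)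
  refine ⟨hOmu, ?_⟩
  -- bounds with the scalar resolvent
  have hB : ∀ (F : Ω → E) (f : Ω → ℝ), (∀ᵐ ω ∂μ, g ω * ‖F ω‖ ≤ f ω) →
      ∀ z ∈ Metric.closedBall c R, ∀ᵐ ω ∂μ, ‖(z - ζ ω)⁻¹ • F ω‖ ≤ f ω := by
    intro F f hF z hz
    filter_upwards [hF, hgz z hz] with ω h1 h2
    rw [norm_smul]
    exact (mul_le_mul_of_nonneg_right h2.2 (norm_nonneg _)).trans h1
  have hb3' : ∀ᵐ ω ∂μ, g ω * ‖ζ ω • (RL ω * (K ω * RH ω))‖ ≤ C * h ω := by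
    filter_upwards [hgC, hb3] with ω h1 h2
    exact mul_le_mul h1.2 h2 (norm_nonneg _) hC.le
  have hbK : ∀ᵐ ω ∂μ, g ω * ‖K ω‖ ≤ C * ‖K ω‖ := by
    filter_upwards [hgC] with ω h1
    exact mul_le_mul_of_nonneg_right h1.2 (norm_nonneg _)
  have hi1 : ∀ z ∈ Metric.closedBall c R,
      Integrable (fun ω => (z - ζ ω)⁻¹ • (ζ ω • (K ω * RH ω))) μ := fun z hz =>
    hh.mono' ((hzm z).smul hm1) (hB _ _ hb1 z hz)
  have hi2 : ∀ z ∈ Metric.closedBall c R,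
      Integrable (fun ω => (z - ζ ω)⁻¹ • (ζ ω • (RL ω * K ω))) μ := fun z hz =>
    hh.mono' ((hzm z).smul hm2) (hB _ _ hb2 z hz)
  have hi3 : ∀ z ∈ Metric.closedBall c R,
      Integrable (fun ω => (z - ζ ω)⁻¹ • (ζ ω • (RL ω * (K ω * RH ω)))) μ := fun z hz =>
    (hh.const_mul C).mono' ((hzm z).smul hm3) (hB _ _ hb3' z hz)
  have hiK : ∀ z ∈ Metric.closedBall c R,
      Integrable (fun ω => (z / (z - ζ ω)) • K ω) μ := fun z hz => by
    have : Integrable (fun ω => (z - ζ ω)⁻¹ • K ω) μ :=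
      (hK.norm.const_mul C).mono' ((hzm z).smul hKm) (hB _ _ hbK z hz)
    refine (this.smul z).congr (Filter.Eventually.of_forall fun ω => ?_)
    simp [div_eq_mul_inv, mul_smul]
  set W1 : ℂ → E := fun z => ∫ ω, (z - ζ ω)⁻¹ • (ζ ω • (K ω * RH ω)) ∂μ with hW1
  set W2 : ℂ → E := fun z => ∫ ω, (z - ζ ω)⁻¹ • (ζ ω • (RL ω * K ω)) ∂μ with hW2
  set G : ℂ → E := fun z => ∫ ω, (z - ζ ω)⁻¹ • (ζ ω • (RL ω * (K ω * RH ω))) ∂μ with hG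
  set M : ℂ → E := fun z => A - z • 1 + ∫ ω, (z / (z - ζ ω)) • K ω ∂μ with hM
  have hu1 : ∀ z ∈ Metric.closedBall c R, IsUnit (1 + W1 z) := fun z hz =>
    hsm _ ((norm_integral_le_of_norm_le hh (hB _ _ hb1 z hz)).trans_lt hh1)
  have hu2 : ∀ z ∈ Metric.closedBall c R, IsUnit (1 + W2 z) := fun z hz =>
    hsm _ ((norm_integral_le_of_norm_le hh (hB _ _ hb2 z hz)).trans_lt hh1)
  have hδ : ∀ z ∈ Metric.closedBall c R, ∀ᵐ ω ∂μ, C⁻¹ ≤ ‖z - ζ ω‖ := fun z hz => by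
    filter_upwards [hgC, hgz z hz] with ω h1 h2
    rw [inv_le_comm₀ hC (norm_pos_iff.2 h2.1), ← norm_inv]
    exact h2.2.trans h1.2
  have hd2 : ∀ z ∈ Metric.closedBall c R, DifferentiableAt ℂ W2 z := fun z hz =>
    aux_diff hζ hm2 z C⁻¹ (inv_pos.2 hC) (hδ z hz) (hi2 z hz)
  have hdG : ∀ z ∈ Metric.closedBall c R, DifferentiableAt ℂ G z := fun z hz =>
    aux_diff hζ hm3 z C⁻¹ (inv_pos.2 hC) (hδ z hz) (hi3 z hz)
  -- factorizations
  have hf1 : ∀ z ∈ Metric.closedBall c R, M z = (1 + W1 z) * (A + X - z • 1) := fun z hz => by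
    have e : (∫ ω, (z / (z - ζ ω)) • K ω ∂μ) - X = W1 z * (A + X - z • 1) := by
      conv_lhs => rw [hX]
      rw [← integral_sub (hiK z hz) hXi, hW1]
      rw [← integral_mul_const_of_integrable (hi1 z hz)]
      refine integral_congr_ae ?_
      filter_upwards [hRH, hRH', hgz z hz] with ω h1 h2 h3
      have h4 : (A + X) * RH ω = 1 + ζ ω • RH ω := by
        rw [← h2, sub_mul]; simp
      have h5 : RH ω * (A + X) = 1 + ζ ω • RH ω := by
        rw [← h1, mul_sub]; simp
      have h6 : z / (z - ζ ω) = 1 + (z - ζ ω)⁻¹ * ζ ω := by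
        field_simp [h3.1]; ring
      have h7 : (z - ζ ω)⁻¹ * ζ ω * (z - ζ ω) = ζ ω := by
        field_simp [h3.1]
      have h8 : RH ω * (A + X - z • 1) = 1 - (z - ζ ω) • RH ω := by
        rw [mul_sub, h5, sub_smul]; simp; abel
      rw [h4, h6, smul_mul_assoc, smul_mul_assoc, mul_assoc, h8, smul_smul, mul_sub, mul_add,
        add_smul, smul_sub, mul_smul_comm, mul_smul_comm, smul_smul, h7]
      simp
    have : (∫ ω, (z / (z - ζ ω)) • K ω ∂μ) = W1 z * (A + X - z • 1) + X := by rw [← e]; abel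
    simp only [hM]
    rw [this, add_mul, one_mul]; abel
  have hf2 : ∀ z ∈ Metric.closedBall c R, M z = (A + Y - z • 1) * (1 + W2 z) := fun z hz => by
    have e : (∫ ω, (z / (z - ζ ω)) • K ω ∂μ) - Y = (A + Y - z • 1) * W2 z := by
      conv_lhs => rw [hY]
      rw [← integral_sub (hiK z hz) hYi, hW2]
      rw [← integral_const_mul_of_integrable (hi2 z hz)]
      refine integral_congr_ae ?_
      filter_upwards [hRL, hRL', hgz z hz] with ω h1 h2 h3
      have h4 : (A + Y) * RL ω = 1 + ζ ω • RL ω := by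
        rw [← h1, sub_mul]; simp
      have h5 : RL ω * (A + Y) = 1 + ζ ω • RL ω := by
        rw [← h2, mul_sub]; simp
      have h6 : z / (z - ζ ω) = 1 + (z - ζ ω)⁻¹ * ζ ω := by
        field_simp [h3.1]; ring
      have h7 : (z - ζ ω)⁻¹ * ζ ω * (z - ζ ω) = ζ ω := by
        field_simp [h3.1]
      have h8 : (A + Y - z • 1) * RL ω = 1 - (z - ζ ω) • RL ω := by
        rw [sub_mul, h4, sub_smul]; simp; abel
      rw [h5, h6, mul_smul_comm, mul_smul_comm, ← mul_assoc, h8, smul_smul, sub_mul, add_mul,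
        add_smul, smul_sub, smul_mul_assoc, smul_mul_assoc, smul_smul, h7]
      simp
    have : (∫ ω, (z / (z - ζ ω)) • K ω ∂μ) = (A + Y - z • 1) * W2 z + Y := by rw [← e]; abel
    simp only [hM]
    rw [this, mul_add, mul_one]; abel
  have hf3 : ∀ z ∈ Metric.closedBall c R, 1 + Om = (1 + W1 z) - (A + Y - z • 1) * G z :=
      fun z hz => by
    have e : W1 z - Om = (A + Y - z • 1) * G z := by
      rw [hOm, hW1, ← integral_sub (hi1 z hz) hΩi, hG]
      rw [← integral_const_mul_of_integrable (hi3 z hz)]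
      refine integral_congr_ae ?_
      filter_upwards [hRL, hgz z hz] with ω h1 h3
      have h4 : (A + Y) * RL ω = 1 + ζ ω • RL ω := by
        rw [← h1, sub_mul]; simp
      have h7 : (z - ζ ω)⁻¹ * ζ ω * (z - ζ ω) = ζ ω := by
        field_simp [h3.1]
      have h8 : (A + Y - z • 1) * RL ω = 1 - (z - ζ ω) • RL ω := by
        rw [sub_mul, h4, sub_smul]; simp; abel
      rw [mul_smul_comm, mul_smul_comm, ← mul_assoc (A + Y - z • 1), h8, sub_mul, smul_smul,
        smul_smul, smul_sub,
        smul_mul_assoc, smul_smul, h7, one_mul]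
    rw [← e]; abel
  -- on the circle
  have hsub := Metric.sphere_subset_closedBall (x := c) (ε := R)
  have hcirc : Set.EqOn (fun z => Ring.inverse (M z))
      (fun z => (-(resolvent (A + X) z) - Ring.inverse (1 + W2 z) * G z) *
        Ring.inverse (1 + Om)) (Metric.sphere c R) := by
    intro z hz
    have hzb := hsub hz
    have hres : z ∈ resolventSet ℂ (A + X) := by
      by_contra hcon
      have := hspec hcon
      rw [mem_sphere_iff_norm] at hz
      rw [Metric.mem_ball, dist_eq_norm] at this
      linarith
    rw [spectrum.mem_resolventSet_iff] at hres
    have hHz : A + X - z • 1 = -(algebraMap ℂ E z - (A + X)) := by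
      rw [Algebra.algebraMap_eq_smul_one]; abel
    have hHu : IsUnit (A + X - z • 1) := by rw [hHz]; exact hres.neg
    have hMu : IsUnit (M z) := by rw [hf1 z hzb]; exact (hu1 z hzb).mul hHu
    have a1 : Ring.inverse (M z) * (1 + W1 z) = -(resolvent (A + X) z) := by
      have b1 : Ring.inverse (M z) * (1 + W1 z) * (A + X - z • 1) = 1 := by
        rw [mul_assoc, ← hf1 z hzb, Ring.inverse_mul_cancel _ hMu]
      have b2 : (A + X - z • 1) * (-(resolvent (A + X) z)) = 1 := by
        rw [hHz, neg_mul_neg, resolvent, Ring.mul_inverse_cancel _ hres]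
      exact left_inv_eq_right_inv b1 b2
    have a2 : Ring.inverse (M z) * (A + Y - z • 1) = Ring.inverse (1 + W2 z) := by
      have b1 : Ring.inverse (M z) * (A + Y - z • 1) * (1 + W2 z) = 1 := by
        rw [mul_assoc, ← hf2 z hzb, Ring.inverse_mul_cancel _ hMu]
      exact left_inv_eq_right_inv b1 (Ring.mul_inverse_cancel _ (hu2 z hzb))
    have a3 : Ring.inverse (M z) * (1 + Om) =
        -(resolvent (A + X) z) - Ring.inverse (1 + W2 z) * G z := by
      rw [hf3 z hzb, mul_sub, a1, ← mul_assoc, a2]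
    simp only
    rw [← a3, mul_assoc, Ring.mul_inverse_cancel _ hOmu, mul_one]
  have hdQ : ∀ z ∈ Metric.closedBall c R,
      DifferentiableAt ℂ (fun z => Ring.inverse (1 + W2 z) * G z) z := fun z hz => by
    refine DifferentiableAt.mul ?_ (hdG z hz)
    exact DifferentiableAt.comp z (differentiableAt_inverse (hu2 z hz)) ((hd2 z hz).const_add 1)
  have hQ0 : (∮ z in C(c, R), Ring.inverse (1 + W2 z) * G z) = 0 := by
    refine Complex.circleIntegral_eq_zero_of_differentiable_on_off_countable hR.le
      Set.countable_empty (fun z hz => (hdQ z hz).continuousAt.continuousWithinAt)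
      (fun z hz => hdQ z (Metric.ball_subset_closedBall hz.1))
  have hQi : CircleIntegrable (fun z => Ring.inverse (1 + W2 z) * G z) c R :=
    ContinuousOn.circleIntegrable hR.le
      (fun z hz => (hdQ z (hsub hz)).continuousAt.continuousWithinAt)
  have hRi : CircleIntegrable (fun z => -(resolvent (A + X) z)) c R := by
    refine ContinuousOn.circleIntegrable hR.le (fun z hz => ?_)
    have hres : z ∈ resolventSet ℂ (A + X) := by
      by_contra hcon
      have := hspec hcon
      rw [mem_sphere_iff_norm] at hz
      rw [Metric.mem_ball, dist_eq_norm] at this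
      linarith
    exact (spectrum.hasDerivAt_resolvent_const_left hres).continuousAt.neg.continuousWithinAt
  have hmulc : ∀ (f : ℂ → E) (b : E), CircleIntegrable f c R →
      (∮ z in C(c, R), f z * b) = (∮ z in C(c, R), f z) * b := by
    intro f b hf
    have := ((ContinuousLinearMap.mul ℂ E).flip b).intervalIntegral_comp_comm hf.out
    simpa [circleIntegral] using this
  rw [circleIntegral.integral_congr hR.le hcirc, 
    hmulc (fun z => -(resolvent (A + X) z) - Ring.inverse (1 + W2 z) * G z) _ (hRi.sub hQi),
    circleIntegral.integral_sub hRi hQi, hQ0, sub_zero]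
  have hneg : (∮ z in C(c, R), -(resolvent (A + X) z)) =
      -((2 * (Real.pi : ℂ) * Complex.I) • (1 : E)) := by
    rw [← aux_resolvent_circle (A + X) c R hR hspec]
    simp [circleIntegral]
  have hpi : (2 * (Real.pi : ℂ) * Complex.I) ≠ 0 := Complex.two_pi_I_ne_zero
  rw [hneg, neg_mul, smul_mul_assoc, one_mul, smul_neg, neg_smul, neg_neg, smul_smul,
    one_div, inv_mul_cancel₀ hpi, one_smul]

end aux

lemma aux_meas {E : Type*} [NormedRing E] [NormedAlgebra ℂ E] [CompleteSpace E]
    {Ω : Type*} [MeasurableSpace Ω] {μ : Measure Ω} {ζ : Ω → ℂ} (hζ : Measurable ζ)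
    (T : E) (hu : ∀ᵐ ω ∂μ, IsUnit (T - ζ ω • 1)) :
    AEStronglyMeasurable (fun ω => Ring.inverse (T - ζ ω • 1)) μ := by
  let f : ℂ → E := fun z => Ring.inverse (T - z • 1)
  have ho : IsOpen {z : ℂ | IsUnit (T - z • (1 : E))} :=
    Units.isOpen.preimage (f := fun z : ℂ => T - z • (1 : E)) (by fun_prop)
  have hc : ContinuousOn f {z : ℂ | IsUnit (T - z • (1 : E))} := by
    intro z hz
    have h1 : ContinuousAt (Ring.inverse : E → E) (T - z • 1) :=
      (differentiableAt_inverse (𝕜 := ℂ) hz).continuousAt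
    exact (ContinuousAt.comp (f := fun z : ℂ => T - z • (1 : E)) h1
      (by fun_prop)).continuousWithinAt
  have hm : AEStronglyMeasurable f ((μ.map ζ).restrict {z : ℂ | IsUnit (T - z • (1 : E))}) :=
    hc.aestronglyMeasurable ho.measurableSet
  have hae : ∀ᵐ z ∂(μ.map ζ), z ∈ {z : ℂ | IsUnit (T - z • (1 : E))} :=
    (ae_map_iff hζ.aemeasurable ho.measurableSet).2 hu
  rw [Measure.restrict_eq_self_of_ae_mem hae] at hm
  exact hm.comp_measurable hζ

lemma aux_bound {E : Type*} [CStarAlgebra E] {A : E} (hA : IsSelfAdjoint A) (X : E) (z : ℂ)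
    {r : ℝ} (hX : ‖X‖ ≤ r) (hr : r < Metric.infDist z (spectrum ℂ A))
    (hu : IsUnit (A + X - z • 1)) :
    ‖Ring.inverse (A + X - z • 1)‖ ≤ (Metric.infDist z (spectrum ℂ A) - r)⁻¹ := by
  set d := Metric.infDist z (spectrum ℂ A)
  have hd : 0 < d := lt_of_le_of_lt ((norm_nonneg _).trans hX) hr
  have hdx : ∀ x ∈ spectrum ℂ A, d ≤ ‖x - z‖ := fun x hx => by
    have := Metric.infDist_le_dist_of_mem (x := z) hx
    rwa [dist_comm, dist_eq_norm] at this
  have hne : ∀ x ∈ spectrum ℂ A, x - z ≠ 0 := fun x hx => norm_pos_iff.1 (hd.trans_le (hdx x hx))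
  have hn : IsStarNormal A := hA.isStarNormal
  have hz : z ∈ resolventSet ℂ A := by
    by_contra h
    exact hne z h (sub_self z)
  have hSu : IsUnit (A - z • 1) := by
    rw [spectrum.mem_resolventSet_iff, Algebra.algebraMap_eq_smul_one] at hz
    simpa using hz.neg
  have hcf : cfc (fun x : ℂ => x - z) A = A - z • 1 := by
    rw [cfc_sub (fun x : ℂ => x) (fun _ => z) A, cfc_id' ℂ A, cfc_const z A, Algebra.algebraMap_eq_smul_one]
  have hS : ‖Ring.inverse (A - z • 1)‖ ≤ d⁻¹ := by
    rw [← hcf, ← cfc_inv (fun x : ℂ => x - z) A hne]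
    refine norm_cfc_le (inv_nonneg.2 hd.le) fun x hx => ?_
    rw [norm_inv]
    exact inv_anti₀ hd (hdx x hx)
  set S := Ring.inverse (A - z • 1)
  set T := Ring.inverse (A + X - z • 1)
  have e : T = S - S * X * T := by
    have h1 : S * (A - z • 1) = 1 := Ring.inverse_mul_cancel _ hSu
    have h2 : (A + X - z • 1) * T = 1 := Ring.mul_inverse_cancel _ hu
    have h3 : S * ((A + X - z • 1) * T) = S * (A - z • 1) * T + S * X * T := by noncomm_ring
    rw [h2, h1, mul_one, one_mul] at h3
    exact eq_sub_of_add_eq h3.symm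
  have h4 : ‖T‖ ≤ d⁻¹ + d⁻¹ * r * ‖T‖ := by
    calc ‖T‖ = ‖S - S * X * T‖ := by rw [← e]
      _ ≤ ‖S‖ + ‖S * X * T‖ := norm_sub_le _ _
      _ ≤ ‖S‖ + ‖S‖ * ‖X‖ * ‖T‖ := by
        gcongr
        exact (norm_mul_le _ _).trans (by gcongr; exact norm_mul_le _ _)
      _ ≤ _ := by gcongr
  rw [← one_div, le_div_iff₀ (by linarith)]
  have h5 := mul_le_mul_of_nonneg_left h4 hd.le
  have h6 : d * (d⁻¹ + d⁻¹ * r * ‖T‖) = 1 + r * ‖T‖ := by field_simp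
  rw [h6] at h5
  linarith

lemma aux_num {a d d₀ v n k : ℝ} (ha : 0 ≤ a) (hd₀ : 0 < d₀) (hd : d₀ ≤ d) (hv0 : 0 ≤ v)
    (hv1 : v < 1) (hn : n ≤ a + d) (hk : 0 ≤ k) :
    n * (d - d₀ * (1 - v) / 2)⁻¹ ^ 2 * k ≤
      (d₀ * (a + d₀) * (d₀ - d₀ * (1 - v) / 2)⁻¹ ^ 2) * (k / d) := by
  set r := d₀ * (1 - v) / 2 with hr
  have hr0 : 0 ≤ r := by rw [hr]; have : 0 < 1 - v := by linarith
                         positivity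
  have hrd : r < d₀ := by rw [hr]; nlinarith
  have hdr : 0 < d - r := by linarith
  have hdr0 : 0 < d₀ - r := by linarith
  have hdp : 0 < d := by linarith
  have e1 : d * (d - r)⁻¹ ≤ d₀ * (d₀ - r)⁻¹ := by
    rw [← div_eq_mul_inv, ← div_eq_mul_inv, div_le_div_iff₀ hdr hdr0]; nlinarith
  have e2 : (a + d) * (d - r)⁻¹ ≤ (a + d₀) * (d₀ - r)⁻¹ := by
    rw [← div_eq_mul_inv, ← div_eq_mul_inv, div_le_div_iff₀ hdr hdr0]; nlinarith
  calc n * (d - r)⁻¹ ^ 2 * k ≤ (a + d) * (d - r)⁻¹ ^ 2 * k := by gcongr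
    _ = (d * (d - r)⁻¹) * ((a + d) * (d - r)⁻¹) * (k / d) := by field_simp
    _ ≤ (d₀ * (d₀ - r)⁻¹) * ((a + d₀) * (d₀ - r)⁻¹) * (k / d) := by
        have := inv_pos.2 hdr
        have := inv_pos.2 hdr0
        gcongr
    _ = _ := by ring

lemma aux_num2 {a d₀ v : ℝ} (hd₀ : 0 < d₀) (hv0 : 0 ≤ v)
    (hv2 : v * a < d₀ * (1 - v) ^ 2 / 4) :
    (d₀ * (a + d₀) * (d₀ - d₀ * (1 - v) / 2)⁻¹ ^ 2) * v < 1 := by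
  have e : d₀ - d₀ * (1 - v) / 2 = d₀ * (1 + v) / 2 := by ring
  rw [e, inv_pow]
  have hp : 0 < (d₀ * (1 + v) / 2) ^ 2 := by positivity
  have : d₀ * (a + d₀) * ((d₀ * (1 + v) / 2) ^ 2)⁻¹ * v
    = (d₀ * (a + d₀) * v) / (d₀ * (1 + v) / 2) ^ 2 := by ring
  rw [this, div_lt_one hp]
  nlinarith

/-- Formula (4.10) of Theorem `MHOmega`:
`-(2πi)⁻¹ ∮ M(z)⁻¹ dz = (I + Ω°)⁻¹`, the contour being a positively oriented
circle around `σ(H)` inside `O(Ã,Γ)`. -/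
theorem contour_integral_inverse_transfer
    {H : Type*} [NormedAddCommGroup H] [InnerProductSpace ℂ H] [CompleteSpace H]
    {Ω : Type*} [MeasurableSpace Ω] (μ : Measure Ω)
    (ζ : Ω → ℂ) (hζ : Measurable ζ)
    (K : Ω → H →L[ℂ] H) (hK : Integrable K μ)
    (A : H →L[ℂ] H) (hA : IsSelfAdjoint A)
    (d₀ : ℝ) (hd₀ : 0 < d₀)
    (hdist : ∀ᵐ ω ∂μ, d₀ ≤ Metric.infDist (ζ ω) (spectrum ℂ A))
    (hvInt : Integrable (fun ω => ‖K ω‖ / Metric.infDist (ζ ω) (spectrum ℂ A)) μ)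
    (v : ℝ) (hv : v = ∫ ω, ‖K ω‖ / Metric.infDist (ζ ω) (spectrum ℂ A) ∂μ)
    (hv1 : v < 1) (hv2 : v * ‖A‖ < d₀ * (1 - v) ^ 2 / 4)
    (X X' : H →L[ℂ] H)
    (hXnorm : ‖X‖ ≤ d₀ * (1 - v) / 2 -
      Real.sqrt (d₀ ^ 2 * (1 - v) ^ 2 / 4 - d₀ * v * ‖A‖))
    (hXsol : IsSolution μ ζ K A X)
    (hX'norm : ‖X'‖ ≤ d₀ * (1 - v) / 2 -
      Real.sqrt (d₀ ^ 2 * (1 - v) ^ 2 / 4 - d₀ * v * ‖A‖))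
    (hX'sol : IsSolution μ (fun ω => (starRingEnd ℂ) (ζ ω))
      (fun ω => ContinuousLinearMap.adjoint (K ω)) A X')
    (c : ℂ) (R : ℝ) (hR : 0 < R)
    (hball : Metric.closedBall c R ⊆
      {z : ℂ | Metric.infDist z (spectrum ℂ A) ≤ d₀ * (1 - v) / 2})
    (hspec : spectrum ℂ (A + X) ⊆ Metric.ball c R) :
    IsUnit ((1 : H →L[ℂ] H) +
      OmegaOp μ ζ K (ContinuousLinearMap.adjoint (A + X')) (A + X)) ∧
    (-(1 / (2 * (Real.pi : ℂ) * Complex.I))) •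
        (∮ z in C(c, R), Ring.inverse (Mtr μ ζ K A z)) =
      Ring.inverse ((1 : H →L[ℂ] H) +
        OmegaOp μ ζ K (ContinuousLinearMap.adjoint (A + X')) (A + X)) := by
  rcases subsingleton_or_nontrivial H with hsub | hnt
  · have : Subsingleton (H →L[ℂ] H) := ⟨fun f g => by ext x; exact Subsingleton.elim _ _⟩
    exact ⟨by rw [Subsingleton.elim (1 + _) (1 : H →L[ℂ] H)]; exact isUnit_one,
      Subsingleton.elim _ _⟩
  have hv0 : 0 ≤ v := by
    rw [hv]
    exact integral_nonneg fun ω => div_nonneg (norm_nonneg _) Metric.infDist_nonneg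
  have hr0 : d₀ * (1 - v) / 2 < d₀ := by nlinarith
  have hsq := Real.sqrt_nonneg (d₀ ^ 2 * (1 - v) ^ 2 / 4 - d₀ * v * ‖A‖)
  have hXr : ‖X‖ ≤ d₀ * (1 - v) / 2 := hXnorm.trans (by linarith)
  have hX'r : ‖adjoint X'‖ ≤ d₀ * (1 - v) / 2 := by
    rw [LinearIsometryEquiv.norm_map]
    exact hX'norm.trans (by linarith)
  obtain ⟨hXu, hXi, hXe⟩ := hXsol
  obtain ⟨hYu, hYi, hYe⟩ := hX'sol
  have hAd : adjoint (A + X') = A + adjoint X' := by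
    rw [map_add]
    congr 1
  have hconj : ∀ w : ℂ, adjoint (A + X' - (starRingEnd ℂ) w • (1 : H →L[ℂ] H)) =
      A + adjoint X' - w • (1 : H →L[ℂ] H) := by
    intro w
    rw [← hAd, ← star_eq_adjoint, ← star_eq_adjoint, star_sub, star_smul, star_one]
    simp
  have hYu' : ∀ᵐ ω ∂μ, IsUnit (A + adjoint X' - ζ ω • (1 : H →L[ℂ] H)) := by
    filter_upwards [hYu] with ω hω
    rw [← hconj, ← star_eq_adjoint]
    exact hω.star
  have hinv : ∀ T : H →L[ℂ] H, IsUnit T → star (Ring.inverse T) = Ring.inverse (star T) := by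
    intro T hT
    have h1 : star (Ring.inverse T) * star T = 1 := by
      rw [← star_mul, Ring.mul_inverse_cancel _ hT, star_one]
    exact left_inv_eq_right_inv h1 (Ring.mul_inverse_cancel _ hT.star)
  have hfun : ∀ᵐ ω ∂μ, star (adjoint (K ω) ∘L ((A + X') ∘L
      Ring.inverse (A + X' - (starRingEnd ℂ) (ζ ω) • (1 : H →L[ℂ] H)))) =
      Ring.inverse (A + adjoint X' - ζ ω • (1 : H →L[ℂ] H)) * (A + adjoint X') * K ω := by
    filter_upwards [hYu] with ω hω
    change star (star (K ω) * ((A + X') *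
      Ring.inverse (A + X' - (starRingEnd ℂ) (ζ ω) • (1 : H →L[ℂ] H)))) = _
    rw [star_mul, star_mul, star_star, hinv _ hω, star_eq_adjoint, star_eq_adjoint, hconj, hAd]
  have hYi' : Integrable (fun ω => Ring.inverse (A + adjoint X' - ζ ω • (1 : H →L[ℂ] H)) *
      (A + adjoint X') * K ω) μ := by
    have h1 := ((starL' ℝ : (H →L[ℂ] H) ≃L[ℝ] (H →L[ℂ] H)) :
      (H →L[ℂ] H) →L[ℝ] (H →L[ℂ] H)).integrable_comp hYi
    exact h1.congr hfun
  have hYe' : adjoint X' = ∫ ω, Ring.inverse (A + adjoint X' - ζ ω • (1 : H →L[ℂ] H)) *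
      (A + adjoint X') * K ω ∂μ := by
    have h1 := ((starL' ℝ : (H →L[ℂ] H) ≃L[ℝ] (H →L[ℂ] H)) :
      (H →L[ℂ] H) →L[ℝ] (H →L[ℂ] H)).integral_comp_comm hYi
    rw [← hYe] at h1
    refine Eq.trans ?_ (h1.symm.trans (integral_congr_ae hfun))
    rfl
  have hne : (spectrum ℂ A).Nonempty := spectrum.nonempty A
  have hζn : ∀ ω, ‖ζ ω‖ ≤ ‖A‖ + Metric.infDist (ζ ω) (spectrum ℂ A) := by
    intro ω
    obtain ⟨x, hx, hxd⟩ := (spectrum.isCompact (𝕜 := ℂ) A).exists_infDist_eq_dist hne (ζ ω)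
    rw [hxd, dist_eq_norm]
    have h1 : ‖x‖ ≤ ‖A‖ := spectrum.norm_le_norm_of_mem hx
    have h2 : ‖ζ ω‖ ≤ ‖x‖ + ‖ζ ω - x‖ := by
      have := norm_add_le x (ζ ω - x)
      simpa using this
    linarith
  have main := aux_main (μ := μ) hζ hK A X (adjoint X')
    (fun ω => Ring.inverse (A + X - ζ ω • (1 : H →L[ℂ] H)))
    (fun ω => Ring.inverse (A + adjoint X' - ζ ω • (1 : H →L[ℂ] H)))
    (aux_meas hζ _ hXu) (aux_meas hζ _ hYu')
    (hXu.mono fun ω h => Ring.inverse_mul_cancel _ h)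
    (hYu'.mono fun ω h => Ring.mul_inverse_cancel _ h)
    (hXu.mono fun ω h => Ring.mul_inverse_cancel _ h)
    (hYu'.mono fun ω h => Ring.inverse_mul_cancel _ h)
    hXi hXe hYi' hYe'
    (fun ω => (Metric.infDist (ζ ω) (spectrum ℂ A) - d₀ * (1 - v) / 2)⁻¹)
    (fun ω => (d₀ * (‖A‖ + d₀) * (d₀ - d₀ * (1 - v) / 2)⁻¹ ^ 2) *
      (‖K ω‖ / Metric.infDist (ζ ω) (spectrum ℂ A)))
    ((d₀ - d₀ * (1 - v) / 2)⁻¹) (inv_pos.2 (by linarith))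
    (hdist.mono fun ω h => ⟨inv_nonneg.2 (by linarith), inv_anti₀ (by linarith) (by linarith)⟩)
    ((hdist.and hXu).mono fun ω h => aux_bound hA X (ζ ω) hXr (by linarith [h.1]) h.2)
    ((hdist.and hYu').mono fun ω h => aux_bound hA _ (ζ ω) hX'r (by linarith [h.1]) h.2)
    c R hR ?_ (hvInt.const_mul _)
    (hdist.mono fun ω h => aux_num (norm_nonneg A) hd₀ h hv0 hv1 (hζn ω) (norm_nonneg _))
    (by rw [integral_const_mul, ← hv]; exact aux_num2 hd₀ hv0 hv2) hspec
  · rw [hAd]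
    exact main
  · intro z hz
    have h1 : Metric.infDist z (spectrum ℂ A) ≤ d₀ * (1 - v) / 2 := hball hz
    filter_upwards [hdist] with ω hω
    have h2 : Metric.infDist (ζ ω) (spectrum ℂ A) ≤ Metric.infDist z (spectrum ℂ A) + ‖z - ζ ω‖ := by
      have := Metric.infDist_le_infDist_add_dist (s := spectrum ℂ A) (x := ζ ω) (y := z)
      rwa [dist_comm, dist_eq_norm] at this
    have h3 : 0 < ‖z - ζ ω‖ := by linarith
    refine ⟨norm_pos_iff.1 h3, ?_⟩
    rw [norm_inv]
    exact inv_anti₀ (by linarith) (by linarith)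
end

section
/- Under the smallness conditions v < 1 and v·‖Ã‖ < d₀(1−v)²/4, let X, X⁻, H := Ã + X, H⁻ := Ã + X⁻ and Ω° be as in Theorem 'MHOmega'. Let c ∈ ℂ and R > 0 be such that the closed disk { z : |z−c| ≤ R } is contained in O(Ã,Γ) := { z : dist(z, σ(Ã)) ≤ d₀(1−v)/2 } and the spectrum of H is contained in the open disk { z : |z−c| < R }. Then −(1/(2πi)) ∮_{|z−c|=R} z·M(z)⁻¹ dz = (I + Ω°)⁻¹ ∘ (H⁻)* = H ∘ (I + Ω°)⁻¹. In particular H* = (I + Ω°⁻) ∘ H⁻ ∘ (I + Ω°⁻)⁻¹, where Ω°⁻ is the analogous operator for the conjugate datum, so (H⁻)* and H have equal spectra. -/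
open MeasureTheory ContinuousLinearMap

section CoreLemmas

set_option linter.unusedSectionVars false

variable {B : Type*} [NormedRing B] [NormedAlgebra ℂ B] [CompleteSpace B]

lemma cz_inverse_eq_resolvent (h : B) (z : ℂ) :
    Ring.inverse (h - z • (1 : B)) = - resolvent h z := by
  have e : h - z • (1 : B) = -(algebraMap ℂ B z - h) := by
    rw [Algebra.algebraMap_eq_smul_one, neg_sub]
  rw [e, resolvent]
  by_cases hu : IsUnit (algebraMap ℂ B z - h)
  · obtain ⟨u, hu⟩ := hu
    rw [← hu, ← Units.val_neg, Ring.inverse_unit, Ring.inverse_unit]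
    simp
  · rw [Ring.inverse_non_unit _ hu, Ring.inverse_non_unit, neg_zero]
    rwa [IsUnit.neg_iff]

lemma cz_isUnit_iff (h : B) (z : ℂ) : IsUnit (h - z • (1 : B)) ↔ z ∉ spectrum ℂ h := by
  rw [spectrum.notMem_iff, ← IsUnit.neg_iff, neg_sub, Algebra.algebraMap_eq_smul_one]

lemma cz_circle_resolvent (h Q : B) (c : ℂ) (R : ℝ) (hR : 0 < R)
    (hspec : spectrum ℂ h ⊆ Metric.ball c R) :
    (∮ z in C(c, R), z • (Ring.inverse (h - z • (1 : B)) * Q)) =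
      -((2 * (Real.pi : ℂ) * Complex.I) • (h * Q)) := by
  set g : ℂ → B := fun z => -(h * (h - c • (1 : B)) * resolvent h z * Q) with hg
  have hmem : ∀ z, z ∉ Metric.ball c R → z ∈ resolventSet ℂ h := by
    intro z hz
    by_contra hcon
    exact hz (hspec hcon)
  have hgd : ∀ z, z ∉ Metric.ball c R → DifferentiableAt ℂ g z := by
    intro z hz
    have := (spectrum.hasDerivAt_resolvent_const_left (hmem z hz)).differentiableAt
    exact (((differentiableAt_const _).mul this).mul (differentiableAt_const _)).neg
  have hlim : Filter.Tendsto g (Bornology.cobounded ℂ) (nhds 0) := by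
    have h1 := spectrum.resolvent_tendsto_cobounded (𝕜 := ℂ) h
    have h2 := ((h1.const_mul (h * (h - c • (1 : B)))).mul_const Q).neg
    simpa using h2
  have hzero : (∮ z in C(c, R), (z - c)⁻¹ • g z) = 0 := by
    have key : ∀ ε > 0, ‖∮ z in C(c, R), (z - c)⁻¹ • g z‖ ≤ 2 * Real.pi * ε := by
      intro ε hε
      have h3 : ∀ᶠ z in Bornology.cobounded ℂ, ‖g z‖ < ε := by
        have := hlim.norm
        rw [norm_zero] at this
        exact this.eventually (gt_mem_nhds hε)
      obtain ⟨s, -, hs⟩ := (Metric.hasBasis_cobounded_compl_closedBall c).eventually_iff.1 h3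
      set ρ := max R (s + 1) with hρ
      have hρ0 : 0 < ρ := lt_of_lt_of_le hR (le_max_left _ _)
      rw [← Complex.circleIntegral_sub_center_inv_smul_eq_of_differentiable_on_annulus_off_countable
        hR (le_max_left R (s + 1)) Set.countable_empty
        (fun z hz => (hgd z hz.2).continuousAt.continuousWithinAt)
        (fun z hz => hgd z (fun hh => hz.1.2 (Metric.ball_subset_closedBall hh)))]
      have := circleIntegral.norm_integral_le_of_norm_le_const (f := fun z => (z - c)⁻¹ • g z)
        (c := c) (R := ρ) (C := ρ⁻¹ * ε) hρ0.le (by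
          intro z hz
          have hz' : ‖z - c‖ = ρ := by simpa [dist_eq_norm] using hz
          rw [norm_smul, norm_inv, hz']
          refine mul_le_mul_of_nonneg_left (hs ?_).le (by positivity)
          simp only [Set.mem_compl_iff, Metric.mem_closedBall, dist_eq_norm, hz', not_le]
          exact lt_of_lt_of_le (by linarith) (le_max_right R (s+1)))
      refine this.trans (le_of_eq ?_)
      field_simp
    have h0 : ‖∮ z in C(c, R), (z - c)⁻¹ • g z‖ ≤ 0 := by
      refine le_of_forall_pos_le_add (fun ε hε => ?_)
      have := key (ε / (2 * Real.pi)) (by positivity)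
      rw [mul_div_cancel₀ _ (by positivity)] at this
      simpa using this
    exact norm_le_zero_iff.1 h0
  have hsub : ∀ z ∈ Metric.sphere c R, z - c ≠ 0 := by
    intro z hz h0
    have hz' : ‖z - c‖ = R := by simpa [dist_eq_norm] using hz
    rw [h0, norm_zero] at hz'
    exact hR.ne hz'
  have hpt : Set.EqOn (fun z => z • (Ring.inverse (h - z • (1 : B)) * Q))
      (fun z => ((z - c)⁻¹ • g z - Q) - (z - c)⁻¹ • (h * Q)) (Metric.sphere c R) := by
    intro z hz
    have hzn : z ∈ resolventSet ℂ h := hmem z (by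
      simp only [Metric.mem_ball, not_lt]; exact (Metric.mem_sphere.1 hz).ge)
    have hr : (z • (1 : B) - h) * resolvent h z = 1 := by
      rw [← Algebra.algebraMap_eq_smul_one]
      exact Ring.mul_inverse_cancel _ hzn
    have hr' : h * resolvent h z = z • resolvent h z - 1 := by
      rw [sub_mul, smul_mul_assoc, one_mul] at hr
      rw [← hr]; abel
    have hne := hsub z hz
    have e1 : h * (h - c • (1 : B)) * resolvent h z
        = (z - c) • (z • resolvent h z - 1) - h := by
      rw [mul_assoc, sub_mul, hr', smul_mul_assoc, one_mul, mul_sub, mul_sub, mul_smul_comm,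
        mul_smul_comm, hr', mul_one]
      module
    simp only [hg, cz_inverse_eq_resolvent, e1]
    rw [sub_mul, smul_mul_assoc, smul_neg, smul_sub, smul_smul, inv_mul_cancel₀ hne, one_smul,
      sub_mul, one_mul, smul_mul_assoc, neg_mul]
    module
  rw [circleIntegral.integral_congr hR.le hpt]
  have ci1 : CircleIntegrable (fun z => (z - c)⁻¹ • g z) c R := by
    refine ContinuousOn.circleIntegrable hR.le (fun z hz => ContinuousAt.continuousWithinAt ?_)
    refine ContinuousAt.smul (ContinuousAt.inv₀ (by fun_prop) (hsub z hz)) (hgd z ?_).continuousAt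
    simp only [Metric.mem_ball, not_lt]; exact (Metric.mem_sphere.1 hz).ge
  have ci2 : CircleIntegrable (fun z => (z - c)⁻¹ • (h * Q)) c R := by
    refine ContinuousOn.circleIntegrable hR.le (fun z hz => ContinuousAt.continuousWithinAt ?_)
    exact ContinuousAt.smul (ContinuousAt.inv₀ (by fun_prop) (hsub z hz)) continuousAt_const
  have ci3 : CircleIntegrable (fun _ : ℂ => Q) c R := circleIntegrable_const _ _ _
  have i3 : (∮ _ in C(c, R), Q) = 0 :=
    Complex.circleIntegral_eq_zero_of_differentiable_on_off_countable hR.le Set.countable_empty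
      continuousOn_const (fun z _ => differentiableAt_const _)
  have ci13 : CircleIntegrable (fun z => (z - c)⁻¹ • g z - Q) c R := ci1.sub ci3
  rw [circleIntegral.integral_sub ci13 ci2, circleIntegral.integral_sub ci1 ci3, hzero, i3,
    circleIntegral.integral_smul_const, circleIntegral.integral_sub_center_inv c hR.ne']
  simp

variable {Ω : Type*} [MeasurableSpace Ω] {μ : Measure Ω}

lemma cz_integrable_inv {ζ : Ω → ℂ} (hζ : Measurable ζ) {S : Ω → B} (hS : Integrable S μ)
    {z : ℂ} {δ : ℝ} (hδ : 0 < δ) (h : ∀ᵐ ω ∂μ, δ ≤ ‖z - ζ ω‖) :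
    Integrable (fun ω => (z - ζ ω)⁻¹ • S ω) μ := by
  refine Integrable.bdd_smul (φ := fun ω => (z - ζ ω)⁻¹) hS δ⁻¹ ?_ ?_
  · exact ((measurable_const.sub hζ).inv).aestronglyMeasurable
  · filter_upwards [h] with ω hω
    rw [norm_inv]
    exact inv_anti₀ hδ hω

lemma cz_differentiableAt {ζ : Ω → ℂ} (hζ : Measurable ζ) {S : Ω → B} (hS : Integrable S μ)
    {z : ℂ} {δ : ℝ} (hδ : 0 < δ) (h : ∀ᵐ ω ∂μ, δ ≤ ‖z - ζ ω‖) :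
    DifferentiableAt ℂ (fun z => ∫ ω, (z - ζ ω)⁻¹ • S ω ∂μ) z := by
  have hlow : ∀ᵐ ω ∂μ, ∀ x ∈ Metric.ball z (δ / 2), δ / 2 ≤ ‖x - ζ ω‖ := by
    filter_upwards [h] with ω hω x hx
    have h1 : ‖z - x‖ < δ / 2 := by
      rw [Metric.mem_ball, dist_comm, dist_eq_norm] at hx; exact hx
    have h2 : ‖z - ζ ω‖ ≤ ‖z - x‖ + ‖x - ζ ω‖ := by
      simpa using norm_add_le (z - x) (x - ζ ω)
    linarith
  have := hasDerivAt_integral_of_dominated_loc_of_deriv_le (μ := μ) (𝕜 := ℂ)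
    (F := fun z ω => (z - ζ ω)⁻¹ • S ω) (x₀ := z) (s := Metric.ball z (δ / 2))
    (F' := fun z ω => (-1 / (z - ζ ω) ^ 2) • S ω) (bound := fun ω => ((δ / 2) ^ 2)⁻¹ * ‖S ω‖)
    (Metric.ball_mem_nhds _ (by positivity))
    (Filter.Eventually.of_forall fun x =>
      ((measurable_const.sub hζ).inv).aestronglyMeasurable.smul hS.1)
    (cz_integrable_inv hζ hS hδ h)
    (((measurable_const.div ((measurable_const.sub hζ).pow_const 2))).aestronglyMeasurable.smul hS.1)
    (by
      filter_upwards [hlow] with ω hω x hx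
      rw [norm_smul]
      refine mul_le_mul_of_nonneg_right ?_ (norm_nonneg _)
      rw [norm_div, norm_neg, norm_one, norm_pow, one_div]
      exact inv_anti₀ (by positivity) (pow_le_pow_left₀ (by positivity) (hω x hx) 2))
    (hS.norm.const_mul _)
    (by
      filter_upwards [hlow] with ω hω x hx
      have hne : x - ζ ω ≠ 0 := by
        intro h0
        have := hω x hx
        rw [h0, norm_zero] at this
        linarith
      exact (((hasDerivAt_id x).sub_const (ζ ω)).inv hne).smul_const (S ω))
  exact this.2.differentiableAt


lemma cz_intertwine {ζ : Ω → ℂ} {S S' T : Ω → B} {a k h L : B}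
    (hS : Integrable S μ) (hS' : Integrable S' μ) (hT : Integrable T μ)
    (hh : h = a + (k + ∫ ω, S ω ∂μ)) (hL : L = a + (k + ∫ ω, S' ω ∂μ))
    (hLT : ∀ᵐ ω ∂μ, L * T ω = S ω + ζ ω • T ω)
    (hTh : ∀ᵐ ω ∂μ, T ω * h = S' ω + ζ ω • T ω) :
    L * (1 + ∫ ω, T ω ∂μ) = (1 + ∫ ω, T ω ∂μ) * h := by
  have e : L * (∫ ω, T ω ∂μ) - (∫ ω, T ω ∂μ) * h = ∫ ω, S ω ∂μ - ∫ ω, S' ω ∂μ := by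
    rw [← integral_const_mul_of_integrable hT, ← integral_mul_const_of_integrable hT,
      ← integral_sub (hT.const_mul L) (hT.mul_const h), ← integral_sub hS hS']
    refine integral_congr_ae ?_
    filter_upwards [hLT, hTh] with ω h1 h2
    rw [h1, h2]; abel
  have e2 : L * (∫ ω, T ω ∂μ) = (∫ ω, T ω ∂μ) * h + (∫ ω, S ω ∂μ - ∫ ω, S' ω ∂μ) := by
    rw [← e]; abel
  rw [mul_add, add_mul, e2, mul_one, one_mul]
  have e3 : L = h - (∫ ω, S ω ∂μ - ∫ ω, S' ω ∂μ) := by rw [hh, hL]; abel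
  nth_rewrite 1 [e3]
  abel

lemma cz_smul_identity {z w : ℂ} (hne : z - w ≠ 0) (k s : B) :
    (z / (z - w)) • k = k + s + (z - w)⁻¹ • (w • k + w • s - z • s) := by
  have h1 : (z / (z - w)) • k = (z - w)⁻¹ • (((z - w) • k) + w • k) := by
    rw [div_eq_inv_mul, mul_smul, sub_smul]; congr 1; abel
  have h2 : s = (z - w)⁻¹ • ((z - w) • s) := by rw [smul_smul, inv_mul_cancel₀ hne, one_smul]
  have h3 : k = (z - w)⁻¹ • ((z - w) • k) := by rw [smul_smul, inv_mul_cancel₀ hne, one_smul]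
  rw [h1]
  nth_rewrite 3 [h3]
  nth_rewrite 1 [h2]
  rw [← smul_add, ← smul_add]
  congr 1
  module

lemma cz_factor_right {ζ : Ω → ℂ} (hζ : Measurable ζ) {K S : Ω → B} {a h : B}
    (hK : Integrable K μ) (hS : Integrable S μ)
    (hh : h = a + (∫ ω, K ω ∂μ + ∫ ω, S ω ∂μ))
    (hSh : ∀ᵐ ω ∂μ, S ω * h = ζ ω • K ω + ζ ω • S ω)
    {z : ℂ} {δ : ℝ} (hδ : 0 < δ) (hz : ∀ᵐ ω ∂μ, δ ≤ ‖z - ζ ω‖) :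
    a - z • (1 : B) + ∫ ω, (z / (z - ζ ω)) • K ω ∂μ =
      (1 + ∫ ω, (z - ζ ω)⁻¹ • S ω ∂μ) * (h - z • (1 : B)) := by
  have hi := cz_integrable_inv hζ hS hδ hz
  rw [add_mul, one_mul, ← integral_mul_const_of_integrable hi]
  have : ∫ ω, (z / (z - ζ ω)) • K ω ∂μ =
      ∫ ω, K ω + S ω + ((z - ζ ω)⁻¹ • S ω) * (h - z • (1 : B)) ∂μ := by
    refine integral_congr_ae ?_
    filter_upwards [hSh, hz] with ω h1 h2
    have hne : z - ζ ω ≠ 0 := by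
      intro h0; rw [h0, norm_zero] at h2; linarith
    rw [smul_mul_assoc, mul_sub, h1, mul_smul_comm, mul_one]
    exact cz_smul_identity hne _ _
  have hKS : Integrable (fun ω => K ω + S ω) μ := hK.add hS
  rw [this, integral_add hKS (hi.mul_const _), integral_add hK hS, hh]
  abel

lemma cz_factor_left {ζ : Ω → ℂ} (hζ : Measurable ζ) {K S : Ω → B} {a h : B}
    (hK : Integrable K μ) (hS : Integrable S μ)
    (hh : h = a + (∫ ω, K ω ∂μ + ∫ ω, S ω ∂μ))
    (hSh : ∀ᵐ ω ∂μ, h * S ω = ζ ω • K ω + ζ ω • S ω)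
    {z : ℂ} {δ : ℝ} (hδ : 0 < δ) (hz : ∀ᵐ ω ∂μ, δ ≤ ‖z - ζ ω‖) :
    a - z • (1 : B) + ∫ ω, (z / (z - ζ ω)) • K ω ∂μ =
      (h - z • (1 : B)) * (1 + ∫ ω, (z - ζ ω)⁻¹ • S ω ∂μ) := by
  have hi := cz_integrable_inv hζ hS hδ hz
  rw [mul_add, mul_one, ← integral_const_mul_of_integrable hi]
  have : ∫ ω, (z / (z - ζ ω)) • K ω ∂μ =
      ∫ ω, K ω + S ω + (h - z • (1 : B)) * ((z - ζ ω)⁻¹ • S ω) ∂μ := by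
    refine integral_congr_ae ?_
    filter_upwards [hSh, hz] with ω h1 h2
    have hne : z - ζ ω ≠ 0 := by
      intro h0; rw [h0, norm_zero] at h2; linarith
    rw [mul_smul_comm, sub_mul, h1, smul_mul_assoc, one_mul]
    exact cz_smul_identity hne _ _
  have hKS : Integrable (fun ω => K ω + S ω) μ := hK.add hS
  rw [this, integral_add hKS (hi.const_mul _), integral_add hK hS, hh]
  abel

lemma cz_omega_sub {ζ : Ω → ℂ} (hζ : Measurable ζ) {S T : Ω → B} {L : B}
    (hS : Integrable S μ) (hT : Integrable T μ)
    (hLT : ∀ᵐ ω ∂μ, L * T ω = S ω + ζ ω • T ω)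
    {z : ℂ} {δ : ℝ} (hδ : 0 < δ) (hz : ∀ᵐ ω ∂μ, δ ≤ ‖z - ζ ω‖) :
    (1 + ∫ ω, T ω ∂μ) - (1 + ∫ ω, (z - ζ ω)⁻¹ • S ω ∂μ) =
      -((L - z • (1 : B)) * ∫ ω, (z - ζ ω)⁻¹ • T ω ∂μ) := by
  have hi := cz_integrable_inv hζ hS hδ hz
  have hj := cz_integrable_inv hζ hT hδ hz
  rw [← integral_const_mul_of_integrable hj, add_sub_add_left_eq_sub, ← integral_sub hT hi,
    ← integral_neg]
  refine integral_congr_ae ?_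
  filter_upwards [hLT, hz] with ω h1 h2
  have hne : z - ζ ω ≠ 0 := by
    intro h0; rw [h0, norm_zero] at h2; linarith
  have h3 : T ω = (z - ζ ω)⁻¹ • ((z - ζ ω) • T ω) := by
    rw [smul_smul, inv_mul_cancel₀ hne, one_smul]
  rw [mul_smul_comm, sub_mul, h1, smul_mul_assoc, one_mul]
  nth_rewrite 1 [h3]
  module

/-- The abstract contour integral formula. -/
lemma cz_contour {ζ : Ω → ℂ} (hζ : Measurable ζ) {K S S' T : Ω → B} {a h L : B}
    (hK : Integrable K μ) (hS : Integrable S μ) (hS' : Integrable S' μ) (hT : Integrable T μ)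
    (hh : h = a + (∫ ω, K ω ∂μ + ∫ ω, S ω ∂μ)) (hL : L = a + (∫ ω, K ω ∂μ + ∫ ω, S' ω ∂μ))
    (hSh : ∀ᵐ ω ∂μ, S ω * h = ζ ω • K ω + ζ ω • S ω)
    (hLS' : ∀ᵐ ω ∂μ, L * S' ω = ζ ω • K ω + ζ ω • S' ω)
    (hLT : ∀ᵐ ω ∂μ, L * T ω = S ω + ζ ω • T ω)
    (c : ℂ) (R : ℝ) (hR : 0 < R) {δ : ℝ} (hδ : 0 < δ)
    (hz : ∀ z ∈ Metric.closedBall c R, ∀ᵐ ω ∂μ, δ ≤ ‖z - ζ ω‖)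
    (hW : ∀ z ∈ Metric.closedBall c R, IsUnit (1 + ∫ ω, (z - ζ ω)⁻¹ • S ω ∂μ))
    (hW' : ∀ z ∈ Metric.closedBall c R, IsUnit (1 + ∫ ω, (z - ζ ω)⁻¹ • S' ω ∂μ))
    (hU : IsUnit (1 + ∫ ω, T ω ∂μ))
    (hspec : spectrum ℂ h ⊆ Metric.ball c R) (hspecL : spectrum ℂ L ⊆ Metric.ball c R) :
    (∮ z in C(c, R), z •
        Ring.inverse (a - z • (1 : B) + ∫ ω, (z / (z - ζ ω)) • K ω ∂μ)) =
      -((2 * (Real.pi : ℂ) * Complex.I) • (h * Ring.inverse (1 + ∫ ω, T ω ∂μ))) := by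
  set Q := Ring.inverse (1 + ∫ ω, T ω ∂μ) with hQ
  set F : ℂ → B := fun z => z • (Ring.inverse (1 + ∫ ω, (z - ζ ω)⁻¹ • S' ω ∂μ) *
    (∫ ω, (z - ζ ω)⁻¹ • T ω ∂μ) * Q) with hF
  have hFd : ∀ z ∈ Metric.closedBall c R, DifferentiableAt ℂ F z := by
    intro z hzm
    have d1 := cz_differentiableAt hζ hS' hδ (hz z hzm)
    have d2 := cz_differentiableAt hζ hT hδ (hz z hzm)
    have d3 := ((differentiableAt_const (1 : B)).add d1).inverse (hW' z hzm)
    exact differentiableAt_id.smul ((d3.mul d2).mul (differentiableAt_const Q))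
  have hF0 : (∮ z in C(c, R), F z) = 0 :=
    Complex.circleIntegral_eq_zero_of_differentiable_on_off_countable hR.le Set.countable_empty
      (fun z hzm => (hFd z hzm).continuousAt.continuousWithinAt)
      (fun z hzm => hFd z (Metric.ball_subset_closedBall hzm.1))
  have hout : ∀ z ∈ Metric.sphere c R, z ∉ Metric.ball c R := by
    intro z hzm
    simp only [Metric.mem_ball, not_lt]; exact (Metric.mem_sphere.1 hzm).ge
  have hpt : Set.EqOn (fun z => z •
        Ring.inverse (a - z • (1 : B) + ∫ ω, (z / (z - ζ ω)) • K ω ∂μ))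
      (fun z => z • (Ring.inverse (h - z • (1 : B)) * Q) - F z) (Metric.sphere c R) := by
    intro z hzs
    have hzm := Metric.sphere_subset_closedBall hzs
    have f1 := cz_factor_right hζ hK hS hh hSh hδ (hz z hzm)
    have f2 := cz_factor_left hζ hK hS' hL hLS' hδ (hz z hzm)
    have f3 := cz_omega_sub hζ hS hT hLT hδ (hz z hzm)
    have uh : IsUnit (h - z • (1 : B)) := (cz_isUnit_iff h z).2 fun hh => hout z hzs (hspec hh)
    have uL : IsUnit (L - z • (1 : B)) := (cz_isUnit_iff L z).2 fun hh => hout z hzs (hspecL hh)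
    have uW := hW z hzm
    have uW' := hW' z hzm
    simp only [hF]
    rw [← smul_sub]
    congr 1
    generalize (a - z • (1 : B) + ∫ ω, (z / (z - ζ ω)) • K ω ∂μ) = M at *
    generalize (1 + ∫ ω, (z - ζ ω)⁻¹ • S ω ∂μ) = W at *
    generalize (1 + ∫ ω, (z - ζ ω)⁻¹ • S' ω ∂μ) = W' at *
    generalize (∫ ω, (z - ζ ω)⁻¹ • T ω ∂μ) = G at *
    generalize h - z • (1 : B) = hz1 at *
    generalize L - z • (1 : B) = Lz at *
    generalize (1 + ∫ ω, T ω ∂μ) = U at *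
    have uM : IsUnit M := f1 ▸ uW.mul uh
    -- cancel `M` on the left
    have c1 : M * Ring.inverse hz1 = W := by
      rw [f1, mul_assoc, Ring.mul_inverse_cancel _ uh, mul_one]
    have c2 : M * Ring.inverse W' = Lz := by
      rw [f2, mul_assoc, Ring.mul_inverse_cancel _ uW', mul_one]
    refine uM.mul_left_cancel ?_
    rw [Ring.mul_inverse_cancel _ uM, mul_sub, ← mul_assoc, c1, mul_assoc (Ring.inverse W'),
      ← mul_assoc M, c2, ← mul_assoc]
    have f4 : Lz * G = W - U := by rw [← neg_sub, f3, neg_neg]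
    rw [f4, ← sub_mul, sub_sub_cancel, hQ, Ring.mul_inverse_cancel _ hU]
  rw [circleIntegral.integral_congr hR.le hpt, circleIntegral.integral_sub, hF0, sub_zero,
    cz_circle_resolvent h Q c R hR hspec]
  · refine ContinuousOn.circleIntegrable hR.le (fun z hzs => ContinuousAt.continuousWithinAt ?_)
    have uh : IsUnit (h - z • (1 : B)) := (cz_isUnit_iff h z).2 fun hh => hout z hzs (hspec hh)
    have d : DifferentiableAt ℂ (fun z : ℂ => h - z • (1 : B)) z := by fun_prop
    exact (differentiableAt_id.smul ((d.inverse uh).mul (differentiableAt_const Q))).continuousAt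
  · exact ContinuousOn.circleIntegrable hR.le (fun z hzs =>
      (hFd z (Metric.sphere_subset_closedBall hzs)).continuousAt.continuousWithinAt)

end CoreLemmas

section CStarLemmas

variable {B : Type*} [CStarAlgebra B]

lemma cz_resolvent_bound {a : B} (ha : IsSelfAdjoint a) {z : ℂ} {y : B} {p : ℝ}
    (hy : ‖y‖ ≤ p) (hp : p < Metric.infDist z (spectrum ℂ a)) :
    IsUnit (a + y - z • (1 : B)) ∧
    ‖Ring.inverse (a + y - z • (1 : B))‖ ≤ (Metric.infDist z (spectrum ℂ a) - p)⁻¹ := by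
  set d := Metric.infDist z (spectrum ℂ a) with hd
  have hp0 : 0 ≤ p := (norm_nonneg y).trans hy
  have hd0 : 0 < d := hp0.trans_lt hp
  have hlow : ∀ x ∈ spectrum ℂ a, d ≤ ‖x - z‖ := by
    intro x hx
    have := Metric.infDist_le_dist_of_mem (x := z) hx
    rwa [dist_comm, dist_eq_norm] at this
  have hz : z ∉ spectrum ℂ a := by
    intro hz
    have := hlow z hz
    rw [sub_self, norm_zero] at this
    linarith
  have u0 : IsUnit (a - z • (1 : B)) := (cz_isUnit_iff a z).2 hz
  have hn : IsStarNormal a := ha.isStarNormal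
  have hne : ∀ x ∈ spectrum ℂ a, x - z ≠ 0 := by
    intro x hx h0
    have := hlow x hx
    rw [h0, norm_zero] at this
    linarith
  have hcfc : cfc (fun x : ℂ => x - z) a = a - z • (1 : B) := by
    rw [cfc_sub (fun x : ℂ => x) (fun _ => z) a, cfc_id' ℂ a, cfc_const z a,
      Algebra.algebraMap_eq_smul_one]
  have hinv : Ring.inverse (a - z • (1 : B)) = cfc (fun x : ℂ => (x - z)⁻¹) a := by
    rw [cfc_inv (fun x : ℂ => x - z) a hne, hcfc]
  have hb0 : ‖Ring.inverse (a - z • (1 : B))‖ ≤ d⁻¹ := by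
    rw [hinv]
    refine norm_cfc_le (by positivity) fun x hx => ?_
    rw [norm_inv]
    exact inv_anti₀ hd0 (hlow x hx)
  set w0 := Ring.inverse (a - z • (1 : B)) with hw0
  have hfac : a + y - z • (1 : B) = (a - z • (1 : B)) * (1 - (-(w0 * y))) := by
    rw [sub_neg_eq_add, mul_add, mul_one, ← mul_assoc, Ring.mul_inverse_cancel _ u0, one_mul]
    abel
  have hlt : ‖-(w0 * y)‖ < 1 := by
    rw [norm_neg]
    calc ‖w0 * y‖ ≤ ‖w0‖ * ‖y‖ := norm_mul_le _ _
      _ ≤ d⁻¹ * p := mul_le_mul hb0 hy (norm_nonneg _) (by positivity)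
      _ < 1 := by rw [inv_mul_lt_iff₀ hd0]; linarith
  have u1 : IsUnit (a + y - z • (1 : B)) := by
    rw [hfac]; exact u0.mul (isUnit_one_sub_of_norm_lt_one hlt)
  refine ⟨u1, ?_⟩
  set w := Ring.inverse (a + y - z • (1 : B)) with hw
  have hww : w = w0 - w0 * (y * w) := by
    have h1 : (a + y - z • (1 : B)) * w = 1 := Ring.mul_inverse_cancel _ u1
    have h2 : w0 * (a - z • (1 : B)) = 1 := Ring.inverse_mul_cancel _ u0
    have h3 : (a - z • (1 : B)) * w = 1 - y * w := by
      rw [eq_sub_iff_add_eq, ← add_mul]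
      convert h1 using 2
      abel
    calc w = w0 * (a - z • (1 : B)) * w := by rw [h2, one_mul]
      _ = w0 - w0 * (y * w) := by rw [mul_assoc, h3, mul_sub, mul_one]
  have hnw : ‖w‖ ≤ d⁻¹ + d⁻¹ * (p * ‖w‖) := by
    calc ‖w‖ = ‖w0 - w0 * (y * w)‖ := by rw [← hww]
      _ ≤ ‖w0‖ + ‖w0 * (y * w)‖ := norm_sub_le _ _
      _ ≤ ‖w0‖ + ‖w0‖ * (‖y‖ * ‖w‖) := by
          gcongr
          exact (norm_mul_le _ _).trans (by gcongr; exact norm_mul_le _ _)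
      _ ≤ _ := by gcongr
  have hnw2 : d * ‖w‖ ≤ 1 + p * ‖w‖ := by
    have := mul_le_mul_of_nonneg_left hnw hd0.le
    rwa [mul_add, ← mul_assoc, mul_inv_cancel₀ hd0.ne', one_mul] at this
  rw [← one_div, le_div_iff₀ (by linarith)]
  nlinarith

lemma cz_stronglyMeasurable {Ω : Type*} [MeasurableSpace Ω] {ζ : Ω → ℂ} (hζ : Measurable ζ)
    (h : B) : StronglyMeasurable (fun ω => Ring.inverse (h - ζ ω • (1 : B))) := by
  have : StronglyMeasurable (fun z : ℂ => Ring.inverse (h - z • (1 : B))) := by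
    have ho : IsOpen (resolventSet ℂ h) := spectrum.isOpen_resolventSet h
    refine stronglyMeasurable_of_restrict_of_restrict_compl ho.measurableSet ?_ ?_
    · have hc : ContinuousOn (fun z : ℂ => Ring.inverse (h - z • (1 : B))) (resolventSet ℂ h) := by
        intro z hz
        have uh : IsUnit (h - z • (1 : B)) := (cz_isUnit_iff h z).2 (fun hcon => hcon hz)
        have d : DifferentiableAt ℂ (fun z : ℂ => h - z • (1 : B)) z := by fun_prop
        exact (d.inverse uh).continuousAt.continuousWithinAt
      exact (continuousOn_iff_continuous_domRestrict.1 hc).stronglyMeasurable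
    · have : (resolventSet ℂ h)ᶜ.domRestrict (fun z : ℂ => Ring.inverse (h - z • (1 : B)))
          = fun _ => 0 := by
        funext z
        simp only [Set.domRestrict_apply]
        refine Ring.inverse_non_unit _ fun hu => ?_
        exact (cz_isUnit_iff h z).1 hu z.2
      rw [this]
      exact stronglyMeasurable_const
  exact this.comp_measurable hζ

lemma cz_integral_star {Ω : Type*} [MeasurableSpace Ω] {μ : Measure Ω} (f : Ω → B) :
    ∫ ω, star (f ω) ∂μ = star (∫ ω, f ω ∂μ) :=
  (starL' ℝ : B ≃L[ℝ] B).integral_comp_comm f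

lemma cz_integrable_star {Ω : Type*} [MeasurableSpace Ω] {μ : Measure Ω} {f : Ω → B}
    (hf : Integrable f μ) : Integrable (fun ω => star (f ω)) μ :=
  (starL' ℝ : B ≃L[ℝ] B).toContinuousLinearMap.integrable_comp hf

lemma cz_star_resolvent (h : B) (z : ℂ) :
    star (Ring.inverse (h - z • (1 : B))) =
      Ring.inverse (star h - (starRingEnd ℂ) z • (1 : B)) := by
  rw [← Ring.inverse_star]
  simp [star_sub, star_smul]

end CStarLemmas

section CoreTheorem

lemma cz_real_bound {d₀ d p N : ℝ} (hp0 : 0 ≤ p) (hp : p < d₀) (hd : d₀ ≤ d) (hN : 0 ≤ N) :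
    (d + N) * ((d - p)⁻¹ * (d - p)⁻¹) ≤ d₀ * (d₀ + N) / (d₀ - p) ^ 2 * d⁻¹ := by
  have h1 : 0 < d₀ - p := by linarith
  have h2 : 0 < d - p := by linarith
  have h3 : 0 < d := by linarith
  have h0 : 0 < d₀ := by linarith
  rw [← mul_inv, ← div_eq_mul_inv, ← div_eq_mul_inv, div_div, div_le_div_iff₀ (by positivity)
    (by positivity)]
  have a1 : d * (d₀ - p) ≤ d₀ * (d - p) := by nlinarith
  have a2 : (d + N) * (d₀ - p) ≤ (d₀ + N) * (d - p) := by nlinarith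
  have := mul_le_mul a1 a2 (by positivity) (by positivity)
  nlinarith

variable {B : Type*} [CStarAlgebra B] [Nontrivial B]
variable {Ω : Type*} [MeasurableSpace Ω]

lemma cz_norm_le_infDist (a : B) (z : ℂ) : ‖z‖ ≤ Metric.infDist z (spectrum ℂ a) + ‖a‖ := by
  obtain ⟨y, hy, hyd⟩ := (spectrum.isCompact (𝕜 := ℂ) a).exists_infDist_eq_dist
    (spectrum.nonempty a) z
  rw [hyd, dist_eq_norm]
  have h1 := spectrum.norm_le_norm_of_mem hy
  have h2 : ‖z‖ ≤ ‖z - y‖ + ‖y‖ := by simpa using norm_add_le (z - y) y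
  linarith

theorem cz_core (μ : Measure Ω)
    (ζ : Ω → ℂ) (hζ : Measurable ζ)
    (K : Ω → B) (hK : Integrable K μ)
    (a : B) (ha : IsSelfAdjoint a)
    (d₀ p v : ℝ) (hp : p < d₀)
    (hdist : ∀ᵐ ω ∂μ, d₀ ≤ Metric.infDist (ζ ω) (spectrum ℂ a))
    (hvInt : Integrable (fun ω => ‖K ω‖ / Metric.infDist (ζ ω) (spectrum ℂ a)) μ)
    (hv : v = ∫ ω, ‖K ω‖ / Metric.infDist (ζ ω) (spectrum ℂ a) ∂μ)
    (hsmall : v * (d₀ * (d₀ + ‖a‖)) < (d₀ - p) ^ 2)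
    (x x' : B) (hx : ‖x‖ ≤ p) (hx' : ‖x'‖ ≤ p)
    (hint : Integrable (fun ω => K ω * ((a + x) * Ring.inverse (a + x - ζ ω • (1 : B)))) μ)
    (hsol : x = ∫ ω, K ω * ((a + x) * Ring.inverse (a + x - ζ ω • (1 : B))) ∂μ)
    (hint' : Integrable (fun ω => star (K ω) *
      ((a + x') * Ring.inverse (a + x' - (starRingEnd ℂ) (ζ ω) • (1 : B)))) μ)
    (hsol' : x' = ∫ ω, star (K ω) *
      ((a + x') * Ring.inverse (a + x' - (starRingEnd ℂ) (ζ ω) • (1 : B))) ∂μ)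
    (c : ℂ) (R : ℝ) (hR : 0 < R)
    (hball : Metric.closedBall c R ⊆
      {z : ℂ | Metric.infDist z (spectrum ℂ a) ≤ p})
    (hspec : spectrum ℂ (a + x) ⊆ Metric.ball c R)
    (O O' : B)
    (hO : O = ∫ ω, ζ ω • (Ring.inverse (star (a + x') - ζ ω • (1 : B)) *
      (K ω * Ring.inverse (a + x - ζ ω • (1 : B)))) ∂μ)
    (hO' : O' = ∫ ω, (starRingEnd ℂ) (ζ ω) •
      (Ring.inverse (star (a + x) - (starRingEnd ℂ) (ζ ω) • (1 : B)) *
      (star (K ω) * Ring.inverse (a + x' - (starRingEnd ℂ) (ζ ω) • (1 : B)))) ∂μ) :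
    IsUnit (1 + O) ∧
    (-(1 / (2 * (Real.pi : ℂ) * Complex.I))) •
        (∮ z in C(c, R), z • Ring.inverse
          (a - z • (1 : B) + ∫ ω, (z / (z - ζ ω)) • K ω ∂μ)) =
      Ring.inverse (1 + O) * star (a + x') ∧
    (-(1 / (2 * (Real.pi : ℂ) * Complex.I))) •
        (∮ z in C(c, R), z • Ring.inverse
          (a - z • (1 : B) + ∫ ω, (z / (z - ζ ω)) • K ω ∂μ)) =
      (a + x) * Ring.inverse (1 + O) ∧
    IsUnit (1 + O') ∧
    star (a + x) = (1 + O') * ((a + x') * Ring.inverse (1 + O')) ∧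
    spectrum ℂ (star (a + x')) = spectrum ℂ (a + x) := by
  have hp0 : 0 ≤ p := (norm_nonneg x).trans hx
  have hδ : 0 < d₀ - p := by linarith
  set N := ‖a‖ with hN
  have hN0 : 0 ≤ N := norm_nonneg a
  set d : Ω → ℝ := fun ω => Metric.infDist (ζ ω) (spectrum ℂ a) with hd
  have hL' : star (a + x') = a + star x' := by rw [star_add, ha.star_eq]
  set h := a + x with hh
  set L := star (a + x') with hL
  have hsx' : ‖star x'‖ ≤ p := by rwa [norm_star]
  set Rr : Ω → B := fun ω => Ring.inverse (h - ζ ω • (1 : B)) with hRr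
  set Rl : Ω → B := fun ω => Ring.inverse (L - ζ ω • (1 : B)) with hRl
  have hdist' : ∀ᵐ ω ∂μ, d₀ ≤ d ω := hdist
  have bR : ∀ᵐ ω ∂μ, IsUnit (h - ζ ω • (1 : B)) ∧ ‖Rr ω‖ ≤ (d ω - p)⁻¹ := by
    filter_upwards [hdist'] with ω hω
    exact cz_resolvent_bound ha hx (lt_of_lt_of_le hp hω)
  have bL : ∀ᵐ ω ∂μ, IsUnit (L - ζ ω • (1 : B)) ∧ ‖Rl ω‖ ≤ (d ω - p)⁻¹ := by
    filter_upwards [hdist'] with ω hω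
    simp only [hRl, hL']
    exact cz_resolvent_bound ha hsx' (lt_of_lt_of_le hp hω)
  -- algebra of resolvents
  have mulR : ∀ᵐ ω ∂μ, h * Rr ω = 1 + ζ ω • Rr ω ∧ Rr ω * h = 1 + ζ ω • Rr ω := by
    filter_upwards [bR] with ω hω
    have e1 := Ring.mul_inverse_cancel _ hω.1
    have e2 := Ring.inverse_mul_cancel _ hω.1
    rw [sub_mul, smul_mul_assoc, one_mul, sub_eq_iff_eq_add] at e1
    rw [mul_sub, mul_smul_comm, mul_one, sub_eq_iff_eq_add] at e2
    exact ⟨e1, e2⟩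
  have mulL : ∀ᵐ ω ∂μ, L * Rl ω = 1 + ζ ω • Rl ω ∧ Rl ω * L = 1 + ζ ω • Rl ω := by
    filter_upwards [bL] with ω hω
    have e1 := Ring.mul_inverse_cancel _ hω.1
    have e2 := Ring.inverse_mul_cancel _ hω.1
    rw [sub_mul, smul_mul_assoc, one_mul, sub_eq_iff_eq_add] at e1
    rw [mul_sub, mul_smul_comm, mul_one, sub_eq_iff_eq_add] at e2
    exact ⟨e1, e2⟩
  set S : Ω → B := fun ω => ζ ω • (K ω * Rr ω) with hS
  set S' : Ω → B := fun ω => ζ ω • (Rl ω * K ω) with hS'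
  set T : Ω → B := fun ω => ζ ω • (Rl ω * (K ω * Rr ω)) with hT
  -- the solutions in terms of integrals
  have eS : (fun ω => K ω * (h * Rr ω) - K ω) =ᵐ[μ] S := by
    filter_upwards [mulR] with ω hω
    simp only [hS]
    rw [hω.1, mul_add, mul_one, mul_smul_comm, add_sub_cancel_left]
  have iS : Integrable S μ := (hint.sub hK).congr eS
  have hxS : h = a + (∫ ω, K ω ∂μ + ∫ ω, S ω ∂μ) := by
    rw [← integral_congr_ae eS, integral_sub hint hK, ← hsol, hh]; abel
  have eqstar : (fun ω => star (star (K ω) *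
      ((a + x') * Ring.inverse (a + x' - (starRingEnd ℂ) (ζ ω) • (1 : B))))) =
      fun ω => Rl ω * L * K ω := by
    funext ω
    rw [star_mul, star_mul, star_star, cz_star_resolvent, Complex.conj_conj]
  have hint2 : Integrable (fun ω => Rl ω * L * K ω) μ := by
    rw [← eqstar]; exact cz_integrable_star hint'
  have hsol2 : star x' = ∫ ω, Rl ω * L * K ω ∂μ := by
    rw [← eqstar, cz_integral_star, ← hsol']
  have eS' : (fun ω => Rl ω * L * K ω - K ω) =ᵐ[μ] S' := by
    filter_upwards [mulL] with ω hω
    simp only [hS']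
    rw [hω.2, add_mul, one_mul, smul_mul_assoc, add_sub_cancel_left]
  have iS' : Integrable S' μ := (hint2.sub hK).congr eS'
  have hxS' : L = a + (∫ ω, K ω ∂μ + ∫ ω, S' ω ∂μ) := by
    rw [← integral_congr_ae eS', integral_sub hint2 hK, ← hsol2, hL']; abel
  -- smallness
  set C := d₀ * (d₀ + N) / (d₀ - p) ^ 2 with hC
  have hCv : C * v < 1 := by
    rw [hC, div_mul_eq_mul_div, div_lt_one (by positivity)]
    linarith
  have hsm : ∀ f : Ω → B,
      (∀ᵐ ω ∂μ, ‖f ω‖ ≤ (d ω + N) * ((d ω - p)⁻¹ * (d ω - p)⁻¹) * ‖K ω‖) →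
      (∀ᵐ ω ∂μ, ‖f ω‖ ≤ C * (‖K ω‖ / d ω)) := by
    intro f hf
    filter_upwards [hf, hdist'] with ω h1 h2
    refine h1.trans ?_
    have := mul_le_mul_of_nonneg_right (cz_real_bound hp0 hp h2 hN0) (norm_nonneg (K ω))
    refine this.trans (le_of_eq ?_)
    rw [hC, div_eq_mul_inv (‖K ω‖)]; ring
  have hunit : ∀ f : Ω → B,
      (∀ᵐ ω ∂μ, ‖f ω‖ ≤ (d ω + N) * ((d ω - p)⁻¹ * (d ω - p)⁻¹) * ‖K ω‖) →
      IsUnit (1 + ∫ ω, f ω ∂μ) := by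
    intro f hf
    have h1 := norm_integral_le_of_norm_le (hvInt.const_mul C) (hsm f hf)
    rw [integral_const_mul, ← hv] at h1
    rw [← sub_neg_eq_add]
    exact isUnit_one_sub_of_norm_lt_one (by rw [norm_neg]; linarith)
  have hζn : ∀ ω, ‖ζ ω‖ ≤ d ω + N := fun ω => cz_norm_le_infDist a (ζ ω)
  have bT : ∀ᵐ ω ∂μ, ‖T ω‖ ≤ (d ω + N) * ((d ω - p)⁻¹ * (d ω - p)⁻¹) * ‖K ω‖ := by
    filter_upwards [bR, bL, hdist'] with ω h1 h2 h3
    have h4 : 0 < d ω - p := by linarith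
    calc ‖T ω‖ = ‖ζ ω‖ * ‖Rl ω * (K ω * Rr ω)‖ := norm_smul _ _
      _ ≤ (d ω + N) * ((d ω - p)⁻¹ * (‖K ω‖ * (d ω - p)⁻¹)) := by
          refine mul_le_mul (hζn ω) ?_ (norm_nonneg _) ((norm_nonneg _).trans (hζn ω))
          refine (norm_mul_le _ _).trans (mul_le_mul h2.2 ?_ (norm_nonneg _) (by positivity))
          exact (norm_mul_le _ _).trans (mul_le_mul_of_nonneg_left h1.2 (norm_nonneg _))
      _ = _ := by ring
  have mT : AEStronglyMeasurable T μ := by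
    refine AEStronglyMeasurable.smul hζ.aestronglyMeasurable ?_
    exact (cz_stronglyMeasurable hζ L).aestronglyMeasurable.mul
      (hK.1.mul (cz_stronglyMeasurable hζ h).aestronglyMeasurable)
  have iT : Integrable T μ := (hvInt.const_mul C).mono' mT (hsm T bT)
  have bS : ∀ᵐ ω ∂μ, ‖S ω‖ ≤ (d ω + N) * (d ω - p)⁻¹ * ‖K ω‖ := by
    filter_upwards [bR, hdist'] with ω h1 h3
    have h4 : 0 < d ω - p := by linarith
    calc ‖S ω‖ = ‖ζ ω‖ * ‖K ω * Rr ω‖ := norm_smul _ _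
      _ ≤ (d ω + N) * (‖K ω‖ * (d ω - p)⁻¹) := by
          refine mul_le_mul (hζn ω) ?_ (norm_nonneg _) ((norm_nonneg _).trans (hζn ω))
          exact (norm_mul_le _ _).trans (mul_le_mul_of_nonneg_left h1.2 (norm_nonneg _))
      _ = _ := by ring
  have bS' : ∀ᵐ ω ∂μ, ‖S' ω‖ ≤ (d ω + N) * (d ω - p)⁻¹ * ‖K ω‖ := by
    filter_upwards [bL, hdist'] with ω h1 h3
    have h4 : 0 < d ω - p := by linarith
    calc ‖S' ω‖ = ‖ζ ω‖ * ‖Rl ω * K ω‖ := norm_smul _ _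
      _ ≤ (d ω + N) * ((d ω - p)⁻¹ * ‖K ω‖) := by
          refine mul_le_mul (hζn ω) ?_ (norm_nonneg _) ((norm_nonneg _).trans (hζn ω))
          exact (norm_mul_le _ _).trans (mul_le_mul_of_nonneg_right h1.2 (norm_nonneg _))
      _ = _ := by ring
  have hzlow : ∀ z ∈ Metric.closedBall c R, ∀ ω, d ω - p ≤ ‖z - ζ ω‖ := by
    intro z hz ω
    have h1 : Metric.infDist z (spectrum ℂ a) ≤ p := hball hz
    have h2 : d ω ≤ Metric.infDist z (spectrum ℂ a) + dist (ζ ω) z :=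
      Metric.infDist_le_infDist_add_dist
    rw [dist_comm, dist_eq_norm] at h2
    linarith
  have hWgen : ∀ F : Ω → B, (∀ᵐ ω ∂μ, ‖F ω‖ ≤ (d ω + N) * (d ω - p)⁻¹ * ‖K ω‖) →
      ∀ z ∈ Metric.closedBall c R, IsUnit (1 + ∫ ω, (z - ζ ω)⁻¹ • F ω ∂μ) := by
    intro F hF z hz
    refine hunit _ ?_
    filter_upwards [hF, hdist'] with ω h1 h2
    have h4 : 0 < d ω - p := by linarith
    have h5 : 0 ≤ d ω + N := (norm_nonneg _).trans (hζn ω)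
    rw [norm_smul, norm_inv]
    calc ‖z - ζ ω‖⁻¹ * ‖F ω‖ ≤ (d ω - p)⁻¹ * ((d ω + N) * (d ω - p)⁻¹ * ‖K ω‖) :=
          mul_le_mul (inv_anti₀ h4 (hzlow z hz ω)) h1 (norm_nonneg _) (by positivity)
      _ = _ := by ring
  have hSh : ∀ᵐ ω ∂μ, S ω * h = ζ ω • K ω + ζ ω • S ω := by
    filter_upwards [mulR] with ω hω
    simp only [hS]
    rw [smul_mul_assoc, mul_assoc, hω.2, mul_add, mul_one, mul_smul_comm, smul_add]
  have hLS' : ∀ᵐ ω ∂μ, L * S' ω = ζ ω • K ω + ζ ω • S' ω := by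
    filter_upwards [mulL] with ω hω
    simp only [hS']
    rw [mul_smul_comm, ← mul_assoc, hω.1, add_mul, one_mul, smul_mul_assoc, smul_add]
  have hLT : ∀ᵐ ω ∂μ, L * T ω = S ω + ζ ω • T ω := by
    filter_upwards [mulL] with ω hω
    simp only [hS, hT]
    rw [mul_smul_comm, ← mul_assoc, hω.1, add_mul, one_mul, smul_mul_assoc, smul_add]
  have hTh : ∀ᵐ ω ∂μ, T ω * h = S' ω + ζ ω • T ω := by
    filter_upwards [mulR] with ω hω
    simp only [hS', hT]
    rw [smul_mul_assoc, mul_assoc, mul_assoc, hω.2, mul_add, mul_one, mul_smul_comm, mul_add,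
      mul_smul_comm, smul_add]
  have hO1 : O = ∫ ω, T ω ∂μ := hO
  have hU : IsUnit (1 + O) := by rw [hO1]; exact hunit T bT
  have hinter : L * (1 + O) = (1 + O) * h := by
    rw [hO1]; exact cz_intertwine iS iS' iT hxS hxS' hLT hTh
  have hOO : O' = star O := by
    rw [hO', hO, ← cz_integral_star]
    congr 1
    funext ω
    rw [star_smul, star_mul, star_mul, cz_star_resolvent, cz_star_resolvent, hL, star_star,
      mul_assoc]
    rfl
  have hU' : IsUnit (1 + O') := by
    have := hU.star
    rwa [star_add, star_one, ← hOO] at this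
  have hinter' : (1 + O') * (a + x') = star h * (1 + O') := by
    have := congrArg star hinter
    rwa [star_mul, star_mul, star_add, star_one, ← hOO, hL, star_star] at this
  have hspeceq : spectrum ℂ L = spectrum ℂ h := by
    obtain ⟨u, hu⟩ := hU
    rw [← hu] at hinter
    have : L = u * h * (↑u⁻¹ : B) := by
      rw [← hinter, mul_assoc, Units.mul_inv, mul_one]
    rw [this, spectrum.units_conjugate]
  have hcont := cz_contour hζ hK iS iS' iT hxS hxS' hSh hLS' hLT c R hR hδ
    (fun z hz => by
      filter_upwards [hdist'] with ω hω
      have := hzlow z hz ω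
      linarith)
    (hWgen S bS) (hWgen S' bS') (by rw [← hO1]; exact hU) hspec (by rw [hspeceq]; exact hspec)
  rw [← hO1] at hcont
  have h2pi : (2 * (Real.pi : ℂ) * Complex.I) ≠ 0 := Complex.two_pi_I_ne_zero
  have hmain : (-(1 / (2 * (Real.pi : ℂ) * Complex.I))) •
        (∮ z in C(c, R), z • Ring.inverse
          (a - z • (1 : B) + ∫ ω, (z / (z - ζ ω)) • K ω ∂μ)) =
      h * Ring.inverse (1 + O) := by
    rw [hcont, smul_neg, neg_smul, neg_neg, smul_smul, one_div, inv_mul_cancel₀ h2pi, one_smul]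
  refine ⟨hU, ?_, hmain, hU', ?_, hspeceq⟩
  · rw [hmain]
    refine hU.mul_left_cancel ?_
    rw [← mul_assoc, ← mul_assoc, ← hinter, Ring.mul_inverse_cancel _ hU, one_mul, mul_assoc,
      Ring.mul_inverse_cancel _ hU, mul_one]
  · rw [← mul_assoc, hinter', mul_assoc, Ring.mul_inverse_cancel _ hU', mul_one]

end CoreTheorem

/-- Formula (4.11) of Theorem `MHOmega` together with Remark `HlHml`:
`-(2πi)⁻¹ ∮ z M(z)⁻¹ dz = (I + Ω°)⁻¹ (H⁻)* = H (I + Ω°)⁻¹`, and consequently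
`H* = (I + Ω°⁻) H⁻ (I + Ω°⁻)⁻¹`, so that `σ((H⁻)*) = σ(H)`. -/
theorem contour_integral_z_inverse_transfer
    {H : Type*} [NormedAddCommGroup H] [InnerProductSpace ℂ H] [CompleteSpace H]
    {Ω : Type*} [MeasurableSpace Ω] (μ : Measure Ω)
    (ζ : Ω → ℂ) (hζ : Measurable ζ)
    (K : Ω → H →L[ℂ] H) (hK : Integrable K μ)
    (A : H →L[ℂ] H) (hA : IsSelfAdjoint A)
    (d₀ : ℝ) (hd₀ : 0 < d₀)
    (hdist : ∀ᵐ ω ∂μ, d₀ ≤ Metric.infDist (ζ ω) (spectrum ℂ A))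
    (hvInt : Integrable (fun ω => ‖K ω‖ / Metric.infDist (ζ ω) (spectrum ℂ A)) μ)
    (v : ℝ) (hv : v = ∫ ω, ‖K ω‖ / Metric.infDist (ζ ω) (spectrum ℂ A) ∂μ)
    (hv1 : v < 1) (hv2 : v * ‖A‖ < d₀ * (1 - v) ^ 2 / 4)
    (X X' : H →L[ℂ] H)
    (hXnorm : ‖X‖ ≤ d₀ * (1 - v) / 2 -
      Real.sqrt (d₀ ^ 2 * (1 - v) ^ 2 / 4 - d₀ * v * ‖A‖))
    (hXsol : IsSolution μ ζ K A X)
    (hX'norm : ‖X'‖ ≤ d₀ * (1 - v) / 2 -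
      Real.sqrt (d₀ ^ 2 * (1 - v) ^ 2 / 4 - d₀ * v * ‖A‖))
    (hX'sol : IsSolution μ (fun ω => (starRingEnd ℂ) (ζ ω))
      (fun ω => ContinuousLinearMap.adjoint (K ω)) A X')
    (c : ℂ) (R : ℝ) (hR : 0 < R)
    (hball : Metric.closedBall c R ⊆
      {z : ℂ | Metric.infDist z (spectrum ℂ A) ≤ d₀ * (1 - v) / 2})
    (hspec : spectrum ℂ (A + X) ⊆ Metric.ball c R) :
    IsUnit ((1 : H →L[ℂ] H) +
      OmegaOp μ ζ K (ContinuousLinearMap.adjoint (A + X')) (A + X)) ∧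
    (-(1 / (2 * (Real.pi : ℂ) * Complex.I))) •
        (∮ z in C(c, R), z • Ring.inverse (Mtr μ ζ K A z)) =
      Ring.inverse ((1 : H →L[ℂ] H) +
          OmegaOp μ ζ K (ContinuousLinearMap.adjoint (A + X')) (A + X)) ∘L
        ContinuousLinearMap.adjoint (A + X') ∧
    (-(1 / (2 * (Real.pi : ℂ) * Complex.I))) •
        (∮ z in C(c, R), z • Ring.inverse (Mtr μ ζ K A z)) =
      (A + X) ∘L Ring.inverse ((1 : H →L[ℂ] H) +
        OmegaOp μ ζ K (ContinuousLinearMap.adjoint (A + X')) (A + X)) ∧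
    IsUnit ((1 : H →L[ℂ] H) +
      OmegaOp μ (fun ω => (starRingEnd ℂ) (ζ ω))
        (fun ω => ContinuousLinearMap.adjoint (K ω))
        (ContinuousLinearMap.adjoint (A + X)) (A + X')) ∧
    ContinuousLinearMap.adjoint (A + X) =
      ((1 : H →L[ℂ] H) +
          OmegaOp μ (fun ω => (starRingEnd ℂ) (ζ ω))
            (fun ω => ContinuousLinearMap.adjoint (K ω))
            (ContinuousLinearMap.adjoint (A + X)) (A + X')) ∘L
        ((A + X') ∘L Ring.inverse ((1 : H →L[ℂ] H) +
          OmegaOp μ (fun ω => (starRingEnd ℂ) (ζ ω))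
            (fun ω => ContinuousLinearMap.adjoint (K ω))
            (ContinuousLinearMap.adjoint (A + X)) (A + X'))) ∧
    spectrum ℂ (ContinuousLinearMap.adjoint (A + X')) = spectrum ℂ (A + X) := by
  rcases subsingleton_or_nontrivial H with hH | hH
  · have hs : Subsingleton (H →L[ℂ] H) := ⟨fun f g => by ext x; exact Subsingleton.elim _ _⟩
    refine ⟨isUnit_of_subsingleton _, Subsingleton.elim _ _, Subsingleton.elim _ _,
      isUnit_of_subsingleton _, Subsingleton.elim _ _, ?_⟩
    rw [Subsingleton.elim (ContinuousLinearMap.adjoint (A + X')) (A + X)]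
  have hv0 : 0 ≤ v := by
    rw [hv]
    exact integral_nonneg fun ω => div_nonneg (norm_nonneg _) Metric.infDist_nonneg
  have hsq := Real.sqrt_nonneg (d₀ ^ 2 * (1 - v) ^ 2 / 4 - d₀ * v * ‖A‖)
  have hp : d₀ * (1 - v) / 2 < d₀ := by nlinarith
  have hsmall : v * (d₀ * (d₀ + ‖A‖)) < (d₀ - d₀ * (1 - v) / 2) ^ 2 := by
    have := mul_lt_mul_of_pos_left hv2 hd₀
    nlinarith
  exact cz_core (B := H →L[ℂ] H) μ ζ hζ K hK A hA d₀ (d₀ * (1 - v) / 2) v hp hdist hvInt hv hsmall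
    X X' (by linarith) (by linarith) hXsol.2.1 hXsol.2.2 hX'sol.2.1 hX'sol.2.2 c R hR hball hspec
    _ _ rfl rfl
end

section
/- Under the smallness conditions v < 1 and v·‖Ã‖ < d₀(1−v)²/4, let X, X⁻, H := Ã + X, H⁻ := Ã + X⁻ and Ω° be as in Theorem 'MHOmega'. Let λ be an isolated point of the spectrum of H, and let c ∈ ℂ, R > 0 be such that the closed disk { z : |z−c| ≤ R } is contained in O(Ã,Γ) := { z : dist(z, σ(Ã)) ≤ d₀(1−v)/2 }, σ(H) ∩ { z : |z−c| ≤ R } = {λ}, and λ lies in the open disk. Define P_λ := −(1/(2πi)) ∮_{|z−c|=R} (H − z·I)⁻¹ dz and P_λ⁻* := −(1/(2πi)) ∮_{|z−c|=R} ((H⁻)* − z·I)⁻¹ dz. Then −(1/(2πi)) ∮_{|z−c|=R} M(z)⁻¹ dz = P_λ ∘ (I + Ω°)⁻¹ = (I + Ω°)⁻¹ ∘ P_λ⁻*. -/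
open MeasureTheory ContinuousLinearMap

section Helpers

variable {𝔸 : Type*} [NormedRing 𝔸] [NormedAlgebra ℂ 𝔸] [CompleteSpace 𝔸]
  {Ω : Type*} [MeasurableSpace Ω] {μ : Measure Ω}

lemma diff_cauchy_integral {ζ : Ω → ℂ} (hζ : Measurable ζ) {G : Ω → 𝔸} (hG : Integrable G μ)
    {δ : ℝ} (hδ : 0 < δ) {z₀ : ℂ} (h : ∀ᵐ ω ∂μ, δ ≤ ‖z₀ - ζ ω‖) :
    DifferentiableAt ℂ (fun z => ∫ ω, (z - ζ ω)⁻¹ • G ω ∂μ) z₀ := by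
  have hmeas : ∀ z : ℂ, AEStronglyMeasurable (fun ω => (z - ζ ω)⁻¹ • G ω) μ := fun z =>
    (((measurable_const.sub hζ).inv).aestronglyMeasurable).smul hG.aestronglyMeasurable
  have hmeas2 : ∀ z : ℂ, AEStronglyMeasurable (fun ω => (-1 / (z - ζ ω) ^ 2) • G ω) μ := fun z =>
    ((measurable_const.div ((measurable_const.sub hζ).pow_const 2)).aestronglyMeasurable).smul
      hG.aestronglyMeasurable
  have hlow : ∀ ω, δ ≤ ‖z₀ - ζ ω‖ → ∀ x ∈ Metric.ball z₀ (δ / 2), δ / 2 ≤ ‖x - ζ ω‖ := by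
    intro ω hω x hx
    rw [Metric.mem_ball, dist_eq_norm] at hx
    have h1 : ‖z₀ - ζ ω‖ ≤ ‖x - ζ ω‖ + ‖x - z₀‖ := by
      have : z₀ - ζ ω = (x - ζ ω) - (x - z₀) := by ring
      rw [this]; exact norm_sub_le _ _
    linarith
  refine (hasDerivAt_integral_of_dominated_loc_of_deriv_le
    (F := fun z ω => (z - ζ ω)⁻¹ • G ω) (F' := fun z ω => (-1 / (z - ζ ω) ^ 2) • G ω)
    (bound := fun ω => (1 / (δ / 2) ^ 2) * ‖G ω‖)
    (Metric.ball_mem_nhds z₀ (half_pos hδ)) (Filter.Eventually.of_forall hmeas) ?_ (hmeas2 z₀)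
    ?_ (hG.norm.const_mul _) ?_).2.differentiableAt
  · refine Integrable.mono' (hG.norm.const_mul (1 / δ)) (hmeas z₀) ?_
    filter_upwards [h] with ω hω
    rw [norm_smul, norm_inv, ← one_div]
    gcongr
  · filter_upwards [h] with ω hω x hx
    have := hlow ω hω x hx
    rw [norm_smul, norm_div, norm_pow, norm_neg, norm_one]
    gcongr
  · filter_upwards [h] with ω hω x hx
    have h1 := hlow ω hω x hx
    have h2 : x - ζ ω ≠ 0 := by
      intro h0; rw [h0, norm_zero] at h1; linarith
    exact (((hasDerivAt_id x).sub_const (ζ ω)).inv h2).smul_const (G ω)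

lemma aesm_inverse {ζ : Ω → ℂ} (hζ : Measurable ζ) (T : 𝔸)
    (h : ∀ᵐ ω ∂μ, IsUnit (T - ζ ω • (1 : 𝔸))) :
    AEStronglyMeasurable (fun ω => Ring.inverse (T - ζ ω • (1 : 𝔸))) μ := by
  set U : Set ℂ := {z | IsUnit (T - z • (1 : 𝔸))} with hU
  have hc : Continuous (fun z : ℂ => T - z • (1 : 𝔸)) := by fun_prop
  have hUo : IsOpen U := Units.isOpen.preimage hc
  have hcont : ContinuousOn (fun z : ℂ => Ring.inverse (T - z • (1 : 𝔸))) U := by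
    intro z hz
    obtain ⟨u, hu⟩ := hz
    have h1 : ContinuousAt Ring.inverse (T - z • (1 : 𝔸)) := by
      rw [← hu]; exact NormedRing.inverse_continuousAt u
    exact (ContinuousAt.comp (f := fun z : ℂ => T - z • (1 : 𝔸)) h1
      hc.continuousAt).continuousWithinAt
  have h2 : AEStronglyMeasurable (fun z : ℂ => Ring.inverse (T - z • (1 : 𝔸))) (μ.map ζ) := by
    have h3 := hcont.aestronglyMeasurable (μ := μ.map ζ) hUo.measurableSet
    rwa [Measure.restrict_eq_self_of_ae_mem] at h3
    exact (ae_map_iff hζ.aemeasurable hUo.measurableSet).2 h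
  exact h2.comp_measurable hζ

lemma inverse_bound {a b x : 𝔸} {d s : ℝ} (hd : 0 < d) (hba : b * a = 1) (hb : ‖b‖ ≤ 1 / d)
    (hs : s < d) (hx : ‖x‖ ≤ s) (hu : IsUnit (a + x)) :
    ‖Ring.inverse (a + x)‖ ≤ 1 / (d - s) := by
  set r := Ring.inverse (a + x) with hr
  have h1 : (a + x) * r = 1 := Ring.mul_inverse_cancel _ hu
  have h2 : r = b - b * x * r := by
    have : b * ((a + x) * r) = r + b * x * r := by
      rw [← mul_assoc, mul_add, hba, add_mul, one_mul]
    rw [h1, mul_one] at this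
    exact eq_sub_of_add_eq this.symm
  have h3 : ‖r‖ ≤ 1 / d + 1 / d * s * ‖r‖ := by
    calc ‖r‖ = ‖b - b * x * r‖ := by rw [← h2]
      _ ≤ ‖b‖ + ‖b * x * r‖ := norm_sub_le _ _
      _ ≤ ‖b‖ + ‖b‖ * ‖x‖ * ‖r‖ := by gcongr; exact norm_mul₃_le
      _ ≤ _ := by gcongr
  have h4 : d * ‖r‖ ≤ 1 + s * ‖r‖ := by
    have := mul_le_mul_of_nonneg_left h3 hd.le
    field_simp at this
    linarith
  rw [le_div_iff₀ (by linarith)]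
  linarith

lemma core_residue (ζ : Ω → ℂ) (hζ : Measurable ζ) (K : Ω → 𝔸) (hK : Integrable K μ)
    (A T S : 𝔸)
    (hTu : ∀ᵐ ω ∂μ, IsUnit (T - ζ ω • (1 : 𝔸))) (hSu : ∀ᵐ ω ∂μ, IsUnit (S - ζ ω • (1 : 𝔸)))
    (hG : Integrable (fun ω => ζ ω • (Ring.inverse (T - ζ ω • (1 : 𝔸)) * K ω)) μ)
    (hG' : Integrable (fun ω => ζ ω • (K ω * Ring.inverse (S - ζ ω • (1 : 𝔸)))) μ)
    (hY : Integrable (fun ω => ζ ω • (Ring.inverse (T - ζ ω • (1 : 𝔸)) *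
      (K ω * Ring.inverse (S - ζ ω • (1 : 𝔸))))) μ)
    (hT : T = A + ∫ ω, K ω + ζ ω • (Ring.inverse (T - ζ ω • (1 : 𝔸)) * K ω) ∂μ)
    (hS : S = A + ∫ ω, K ω + ζ ω • (K ω * Ring.inverse (S - ζ ω • (1 : 𝔸))) ∂μ)
    (O : 𝔸) (hO : O = ∫ ω, ζ ω • (Ring.inverse (T - ζ ω • (1 : 𝔸)) *
      (K ω * Ring.inverse (S - ζ ω • (1 : 𝔸)))) ∂μ)
    (hOu : IsUnit (1 + O))
    (c : ℂ) (R : ℝ) (hR : 0 < R) (δ : ℝ) (hδ : 0 < δ)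
    (hδz : ∀ z ∈ Metric.closedBall c R, ∀ᵐ ω ∂μ, δ ≤ ‖z - ζ ω‖)
    (hWu : ∀ z ∈ Metric.closedBall c R, IsUnit (1 +
      ∫ ω, (z - ζ ω)⁻¹ • ζ ω • (Ring.inverse (T - ζ ω • (1 : 𝔸)) * K ω) ∂μ))
    (hsph : ∀ z ∈ Metric.sphere c R, IsUnit (S - z • (1 : 𝔸))) :
    (∮ z in C(c, R), Ring.inverse (A - z • (1 : 𝔸) + ∫ ω, (z / (z - ζ ω)) • K ω ∂μ)) =
      (∮ z in C(c, R), Ring.inverse (S - z • (1 : 𝔸))) * Ring.inverse (1 + O) ∧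
    (∮ z in C(c, R), Ring.inverse (A - z • (1 : 𝔸) + ∫ ω, (z / (z - ζ ω)) • K ω ∂μ)) =
      Ring.inverse (1 + O) * (∮ z in C(c, R), Ring.inverse (T - z • (1 : 𝔸))) := by
  set J := Ring.inverse (1 + O) with hJ
  have hJ1 : J * (1 + O) = 1 := Ring.inverse_mul_cancel _ hOu
  have hJ2 : (1 + O) * J = 1 := Ring.mul_inverse_cancel _ hOu
  -- similarity
  have hcomm : T * O - O * S = S - T := by
    rw [hO, ← integral_const_mul_of_integrable hY, ← integral_mul_const_of_integrable hY,
      ← integral_sub (hY.const_mul T) (hY.mul_const S)]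
    have hKG : Integrable (fun ω => K ω + ζ ω • (Ring.inverse (T - ζ ω • (1 : 𝔸)) * K ω)) μ :=
      hK.add hG
    have hKG' : Integrable (fun ω => K ω + ζ ω • (K ω * Ring.inverse (S - ζ ω • (1 : 𝔸)))) μ :=
      hK.add hG'
    have e1 : S - T = ∫ ω, (K ω + ζ ω • (K ω * Ring.inverse (S - ζ ω • (1 : 𝔸)))) -
        (K ω + ζ ω • (Ring.inverse (T - ζ ω • (1 : 𝔸)) * K ω)) ∂μ := by
      rw [integral_sub hKG' hKG]
      nth_rewrite 1 [hS]
      nth_rewrite 1 [hT]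
      abel
    rw [e1]
    apply integral_congr_ae
    filter_upwards [hTu, hSu] with ω h1 h2
    have a1 := Ring.mul_inverse_cancel _ h1
    have a2 := Ring.inverse_mul_cancel _ h2
    set Rt := Ring.inverse (T - ζ ω • (1 : 𝔸))
    set Rs := Ring.inverse (S - ζ ω • (1 : 𝔸))
    have b1 : T * Rt = 1 + ζ ω • Rt := by
      rw [sub_mul, smul_mul_assoc, one_mul] at a1
      rw [← a1]; abel
    have b2 : Rs * S = 1 + ζ ω • Rs := by
      rw [mul_sub, mul_smul_comm, mul_one] at a2
      rw [← a2]; abel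
    have b3 : T * (Rt * (K ω * Rs)) - (Rt * (K ω * Rs)) * S = K ω * Rs - Rt * K ω := by
      calc _ = (T * Rt) * (K ω * Rs) - Rt * K ω * (Rs * S) := by noncomm_ring
        _ = _ := by
          rw [b1, b2]
          simp only [add_mul, mul_add, one_mul, mul_one, smul_mul_assoc, mul_smul_comm, mul_assoc]
          abel
    simp only [mul_smul_comm, smul_mul_assoc]
    rw [← smul_sub, b3, smul_sub]
    abel
  have hsim : ∀ z : ℂ, (T - z • (1 : 𝔸)) * (1 + O) = (1 + O) * (S - z • (1 : 𝔸)) := by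
    intro z
    have : T * O = O * S + (S - T) := by rw [← hcomm]; abel
    simp only [sub_mul, mul_sub, mul_add, add_mul, mul_one, one_mul, smul_mul_assoc,
      mul_smul_comm, this, smul_add]
    abel
  have hsphT : ∀ z ∈ Metric.sphere c R, IsUnit (T - z • (1 : 𝔸)) := by
    intro z hz
    have : T - z • (1 : 𝔸) = (1 + O) * (S - z • (1 : 𝔸)) * J := by
      rw [← hsim, mul_assoc, hJ2, mul_one]
    rw [this]
    exact (hOu.mul (hsph z hz)).mul hOu.ringInverse
  have hinv : ∀ z ∈ Metric.sphere c R, Ring.inverse (S - z • (1 : 𝔸)) * J =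
      J * Ring.inverse (T - z • (1 : 𝔸)) := by
    intro z hz
    have a1 := Ring.mul_inverse_cancel _ (hsphT z hz)
    have a2 := Ring.inverse_mul_cancel _ (hsph z hz)
    set Rt := Ring.inverse (T - z • (1 : 𝔸))
    set Rs := Ring.inverse (S - z • (1 : 𝔸))
    calc Rs * J = Rs * J * ((T - z • (1 : 𝔸)) * ((1 + O) * J) * Rt) := by
          rw [hJ2, mul_one, a1, mul_one]
      _ = Rs * J * (((T - z • (1 : 𝔸)) * (1 + O)) * J * Rt) := by simp only [mul_assoc]
      _ = Rs * ((J * (1 + O)) * ((S - z • (1 : 𝔸)) * (J * Rt))) := by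
          rw [hsim]; simp only [mul_assoc]
      _ = (Rs * (S - z • (1 : 𝔸))) * (J * Rt) := by rw [hJ1, one_mul, mul_assoc]
      _ = J * Rt := by rw [a2, one_mul]
  have hcontinv : ∀ B : 𝔸, (∀ z ∈ Metric.sphere c R, IsUnit (B - z • (1 : 𝔸))) →
      CircleIntegrable (fun z => Ring.inverse (B - z • (1 : 𝔸))) c R := by
    intro B hB
    apply ContinuousOn.circleIntegrable hR.le
    intro z hz
    have hc : Continuous (fun z : ℂ => B - z • (1 : 𝔸)) := by fun_prop
    obtain ⟨u, hu⟩ := hB z hz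
    have h1 : ContinuousAt Ring.inverse (B - z • (1 : 𝔸)) := by
      rw [← hu]; exact NormedRing.inverse_continuousAt u
    exact (ContinuousAt.comp (f := fun z : ℂ => B - z • (1 : 𝔸)) h1
      hc.continuousAt).continuousWithinAt
  have hmulr : (∮ z in C(c, R), Ring.inverse (S - z • (1 : 𝔸)) * J) =
      (∮ z in C(c, R), Ring.inverse (S - z • (1 : 𝔸))) * J := by
    have h := (hcontinv S hsph).out
    have h2 := ((ContinuousLinearMap.mul ℂ 𝔸).flip J).intervalIntegral_comp_comm h
    simp only [ContinuousLinearMap.flip_apply, ContinuousLinearMap.mul_apply',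
      smul_mul_assoc] at h2
    exact h2
  have hmull : (∮ z in C(c, R), J * Ring.inverse (T - z • (1 : 𝔸))) =
      J * (∮ z in C(c, R), Ring.inverse (T - z • (1 : 𝔸))) := by
    have h := (hcontinv T hsphT).out
    have h2 := ((ContinuousLinearMap.mul ℂ 𝔸) J).intervalIntegral_comp_comm h
    simp only [ContinuousLinearMap.mul_apply', mul_smul_comm] at h2
    exact h2
  have hSJT : (∮ z in C(c, R), Ring.inverse (S - z • (1 : 𝔸))) * J =
      J * (∮ z in C(c, R), Ring.inverse (T - z • (1 : 𝔸))) := by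
    rw [← hmulr, ← hmull]
    exact circleIntegral.integral_congr hR.le hinv
  -- integrability with the Cauchy kernel
  have hcau : ∀ z ∈ Metric.closedBall c R, ∀ F : Ω → 𝔸, Integrable F μ →
      Integrable (fun ω => (z - ζ ω)⁻¹ • F ω) μ := by
    intro z hz F hF
    refine Integrable.mono' (hF.norm.const_mul (1 / δ))
      ((((measurable_const.sub hζ).inv).aestronglyMeasurable).smul hF.aestronglyMeasurable) ?_
    filter_upwards [hδz z hz] with ω hω
    rw [norm_smul, norm_inv, ← one_div]
    gcongr
  set W : ℂ → 𝔸 := fun z => 1 +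
      ∫ ω, (z - ζ ω)⁻¹ • ζ ω • (Ring.inverse (T - ζ ω • (1 : 𝔸)) * K ω) ∂μ with hW
  set Z : ℂ → 𝔸 := fun z =>
      ∫ ω, (z - ζ ω)⁻¹ • ζ ω • (Ring.inverse (T - ζ ω • (1 : 𝔸)) *
      (K ω * Ring.inverse (S - ζ ω • (1 : 𝔸)))) ∂μ with hZ
  have hWd : ∀ z ∈ Metric.closedBall c R, DifferentiableAt ℂ W z := fun z hz =>
    (diff_cauchy_integral hζ hG hδ (hδz z hz)).const_add 1
  have hZd : ∀ z ∈ Metric.closedBall c R, DifferentiableAt ℂ Z z := fun z hz =>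
    diff_cauchy_integral hζ hY hδ (hδz z hz)
  have hWid : ∀ z ∈ Metric.closedBall c R, DifferentiableAt ℂ (fun z => Ring.inverse (W z)) z :=
    fun z hz => DifferentiableAt.comp (g := Ring.inverse) z
      (differentiableAt_inverse (hWu z hz)) (hWd z hz)
  have hDd : ∀ z ∈ Metric.closedBall c R,
      DifferentiableAt ℂ (fun z => -(Ring.inverse (W z) * Z z * J)) z :=
    fun z hz => (((hWid z hz).mul (hZd z hz)).mul_const J).neg
  have hD0 : (∮ z in C(c, R), -(Ring.inverse (W z) * Z z * J)) = 0 := by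
    apply Complex.circleIntegral_eq_zero_of_differentiable_on_off_countable hR.le
      Set.countable_empty
    · exact fun z hz => (hDd z hz).continuousAt.continuousWithinAt
    · exact fun z hz => hDd z (Metric.ball_subset_closedBall hz.1)
  have hne : ∀ z ω, δ ≤ ‖z - ζ ω‖ → z - ζ ω ≠ 0 := by
    intro z ω h h0
    rw [h0, norm_zero] at h; linarith
  -- factorization
  have hM : ∀ z ∈ Metric.closedBall c R, A - z • (1 : 𝔸) + ∫ ω, (z / (z - ζ ω)) • K ω ∂μ =
      (T - z • (1 : 𝔸)) * W z := by
    intro z hz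
    have hi1 := hcau z hz _ hG
    have hi2 : Integrable (fun ω => (z / (z - ζ ω)) • K ω) μ := by
      have := (hcau z hz _ hK).smul z
      refine this.congr (Filter.Eventually.of_forall fun ω => ?_)
      simp only [Pi.smul_apply, smul_smul, div_eq_mul_inv]
    have e : A - T = - ∫ ω, K ω + ζ ω • (Ring.inverse (T - ζ ω • (1 : 𝔸)) * K ω) ∂μ := by
      nth_rewrite 1 [hT]
      abel
    have e2 : (∫ ω, (z / (z - ζ ω)) • K ω ∂μ) -
        (∫ ω, K ω + ζ ω • (Ring.inverse (T - ζ ω • (1 : 𝔸)) * K ω) ∂μ) =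
        (T - z • (1 : 𝔸)) *
          ∫ ω, (z - ζ ω)⁻¹ • ζ ω • (Ring.inverse (T - ζ ω • (1 : 𝔸)) * K ω) ∂μ := by
      have hKG : Integrable (fun ω => K ω + ζ ω • (Ring.inverse (T - ζ ω • (1 : 𝔸)) * K ω)) μ :=
        hK.add hG
      rw [← integral_const_mul_of_integrable hi1, ← integral_sub hi2 hKG]
      apply integral_congr_ae
      filter_upwards [hTu, hδz z hz] with ω h1 h2
      have h3 := hne z ω h2
      have a1 := Ring.mul_inverse_cancel _ h1
      set Rt := Ring.inverse (T - ζ ω • (1 : 𝔸))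
      have b1 : (T - z • (1 : 𝔸)) * (Rt * K ω) = K ω - (z - ζ ω) • (Rt * K ω) := by
        have : T - z • (1 : 𝔸) = (T - ζ ω • (1 : 𝔸)) - (z - ζ ω) • (1 : 𝔸) := by
          rw [sub_smul]; abel
        rw [this, sub_mul, ← mul_assoc, a1, one_mul, smul_mul_assoc, one_mul]
      rw [mul_smul_comm, mul_smul_comm, b1]
      match_scalars
      all_goals (field_simp; try ring)
    rw [hW]
    simp only
    rw [mul_add, mul_one, ← e2]
    rw [sub_eq_iff_eq_add] at e
    nth_rewrite 1 [e]
    abel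
  have hOW : ∀ z ∈ Metric.closedBall c R, (1 + O) - W z = - (Z z * (S - z • (1 : 𝔸))) := by
    intro z hz
    have hi1 := hcau z hz _ hG
    have hi2 := hcau z hz _ hY
    rw [hW, hZ, hO]
    simp only
    rw [add_sub_add_left_eq_sub, ← integral_mul_const_of_integrable hi2, ← integral_sub hY hi1,
      ← integral_neg]
    apply integral_congr_ae
    filter_upwards [hSu, hδz z hz] with ω h1 h2
    have h3 := hne z ω h2
    have a1 := Ring.inverse_mul_cancel _ h1
    set Rt := Ring.inverse (T - ζ ω • (1 : 𝔸))
    set Rs := Ring.inverse (S - ζ ω • (1 : 𝔸))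
    have b1 : (Rt * (K ω * Rs)) * (S - z • (1 : 𝔸)) =
        Rt * K ω - (z - ζ ω) • (Rt * (K ω * Rs)) := by
      have : S - z • (1 : 𝔸) = (S - ζ ω • (1 : 𝔸)) - (z - ζ ω) • (1 : 𝔸) := by
        rw [sub_smul]; abel
      rw [this, mul_sub, mul_smul_comm, mul_one, mul_assoc, mul_assoc, a1, mul_one]
    rw [smul_mul_assoc, smul_mul_assoc, b1]
    match_scalars
    all_goals (field_simp; try ring)
  have hfin : ∀ z ∈ Metric.sphere c R,
      Ring.inverse (A - z • (1 : 𝔸) + ∫ ω, (z / (z - ζ ω)) • K ω ∂μ) =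
      Ring.inverse (S - z • (1 : 𝔸)) * J + -(Ring.inverse (W z) * Z z * J) := by
    intro z hz
    have hz' := Metric.sphere_subset_closedBall hz
    have hu : IsUnit ((T - z • (1 : 𝔸)) * W z) := (hsphT z hz).mul (hWu z hz')
    rw [hM z hz']
    have a1 := Ring.mul_inverse_cancel _ (hsphT z hz)
    have a2 := Ring.mul_inverse_cancel _ (hsph z hz)
    have a3 := Ring.inverse_mul_cancel _ (hWu z hz')
    have a4 := Ring.mul_inverse_cancel _ hu
    have a5 := Ring.inverse_mul_cancel _ hu
    have h1 := hOW z hz'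
    have h2 := hinv z hz
    change Ring.inverse (W z) * W z = 1 at a3
    set Rt := Ring.inverse (T - z • (1 : 𝔸))
    set Rs := Ring.inverse (S - z • (1 : 𝔸))
    set Wi := Ring.inverse (W z)
    set Mi := Ring.inverse ((T - z • (1 : 𝔸)) * W z)
    have h3 : (T - z • (1 : 𝔸)) * W z * (Rs * J + -(Wi * Z z * J)) = 1 := by
      have a6 : W z * Wi = 1 := Ring.mul_inverse_cancel _ (hWu z hz')
      have h4 : W z = (1 + O) + Z z * (S - z • (1 : 𝔸)) := by
        have h6 : W z = (1 + O) - (1 + O - W z) := by abel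
        rw [h6, h1, sub_neg_eq_add]
      have h5 : W z * (Rs * J + -(Wi * Z z * J)) = Rt := by
        calc W z * (Rs * J + -(Wi * Z z * J)) = W z * (Rs * J) - (W z * Wi) * (Z z * J) := by
              noncomm_ring
          _ = W z * (Rs * J) - Z z * J := by rw [a6, one_mul]
          _ = ((1 + O) + Z z * (S - z • (1 : 𝔸))) * (Rs * J) - Z z * J := by rw [← h4]
          _ = (1 + O) * (Rs * J) + Z z * ((S - z • (1 : 𝔸)) * Rs) * J - Z z * J := by
              rw [add_mul]; simp only [mul_assoc]
          _ = (1 + O) * (Rs * J) := by rw [a2, mul_one]; abel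
          _ = Rt := by rw [h2, ← mul_assoc, hJ2, one_mul]
      rw [mul_assoc, h5, a1]
    calc Mi = Mi * ((T - z • (1 : 𝔸)) * W z * (Rs * J + -(Wi * Z z * J))) := by rw [h3, mul_one]
      _ = _ := by rw [← mul_assoc, a5, one_mul]
  have hmain : (∮ z in C(c, R), Ring.inverse (A - z • (1 : 𝔸) +
      ∫ ω, (z / (z - ζ ω)) • K ω ∂μ)) =
      (∮ z in C(c, R), Ring.inverse (S - z • (1 : 𝔸))) * J := by
    rw [circleIntegral.integral_congr hR.le hfin, circleIntegral.integral_add, hD0, add_zero, hmulr]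
    · apply ContinuousOn.circleIntegrable hR.le
      intro z hz
      have hc : Continuous (fun z : ℂ => S - z • (1 : 𝔸)) := by fun_prop
      obtain ⟨u, hu⟩ := hsph z hz
      have h1 : ContinuousAt Ring.inverse (S - z • (1 : 𝔸)) := by
        rw [← hu]; exact NormedRing.inverse_continuousAt u
      exact ((ContinuousAt.comp (f := fun z : ℂ => S - z • (1 : 𝔸)) h1
        hc.continuousAt).mul continuousAt_const).continuousWithinAt
    · apply ContinuousOn.circleIntegrable hR.le
      exact fun z hz =>
        (hDd z (Metric.sphere_subset_closedBall hz)).continuousAt.continuousWithinAt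
  exact ⟨hmain, hmain.trans hSJT⟩

end Helpers

lemma selfadjoint_resolvent {𝔸 : Type*} [CStarAlgebra 𝔸] (A : 𝔸) (hA : IsSelfAdjoint A)
    (w : ℂ) (hd : 0 < Metric.infDist w (spectrum ℂ A)) :
    ∃ b : 𝔸, b * (A - w • (1 : 𝔸)) = 1 ∧ ‖b‖ ≤ 1 / Metric.infDist w (spectrum ℂ A) := by
  have hn : IsStarNormal A := hA.isStarNormal
  have hlow : ∀ x ∈ spectrum ℂ A, Metric.infDist w (spectrum ℂ A) ≤ ‖x - w‖ := by
    intro x hx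
    rw [← dist_eq_norm, dist_comm]
    exact Metric.infDist_le_dist_of_mem hx
  have hne : ∀ x ∈ spectrum ℂ A, x - w ≠ 0 := by
    intro x hx h0
    have := hlow x hx
    rw [h0, norm_zero] at this; linarith
  have hc : ContinuousOn (fun x : ℂ => (x - w)⁻¹) (spectrum ℂ A) :=
    ContinuousOn.inv₀ (by fun_prop) hne
  refine ⟨cfc (fun x : ℂ => (x - w)⁻¹) A, ?_, ?_⟩
  · have h1 : A - w • (1 : 𝔸) = cfc (fun x : ℂ => x - w) A := by
      rw [cfc_sub (fun x : ℂ => x) (fun _ => w) A, cfc_id' ℂ A, cfc_const w A,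
        Algebra.algebraMap_eq_smul_one]
    rw [h1, ← cfc_mul (fun x : ℂ => (x - w)⁻¹) (fun x : ℂ => x - w) A hc (by fun_prop),
      ← cfc_one ℂ A]
    apply cfc_congr
    intro x hx
    simp [hne x hx]
  · refine norm_cfc_le (by positivity) ?_
    intro x hx
    rw [norm_inv, ← one_div]
    exact one_div_le_one_div_of_le hd (hlow x hx)

/-- Theorem `MPOmega` (relations (4.17)): at an isolated eigenvalue `λ` of `H`,
the residue of `M(z)⁻¹` equals `P_λ (I + Ω°)⁻¹ = (I + Ω°)⁻¹ P_λ⁻*`, where `P_λ`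
and `P_λ⁻*` are the Riesz projections of `H` and `(H⁻)*` at `λ`. -/
theorem residue_inverse_transfer_eq_projections
    {H : Type*} [NormedAddCommGroup H] [InnerProductSpace ℂ H] [CompleteSpace H]
    {Ω : Type*} [MeasurableSpace Ω] (μ : Measure Ω)
    (ζ : Ω → ℂ) (hζ : Measurable ζ)
    (K : Ω → H →L[ℂ] H) (hK : Integrable K μ)
    (A : H →L[ℂ] H) (hA : IsSelfAdjoint A)
    (d₀ : ℝ) (hd₀ : 0 < d₀)
    (hdist : ∀ᵐ ω ∂μ, d₀ ≤ Metric.infDist (ζ ω) (spectrum ℂ A))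
    (hvInt : Integrable (fun ω => ‖K ω‖ / Metric.infDist (ζ ω) (spectrum ℂ A)) μ)
    (v : ℝ) (hv : v = ∫ ω, ‖K ω‖ / Metric.infDist (ζ ω) (spectrum ℂ A) ∂μ)
    (hv1 : v < 1) (hv2 : v * ‖A‖ < d₀ * (1 - v) ^ 2 / 4)
    (X X' : H →L[ℂ] H)
    (hXnorm : ‖X‖ ≤ d₀ * (1 - v) / 2 -
      Real.sqrt (d₀ ^ 2 * (1 - v) ^ 2 / 4 - d₀ * v * ‖A‖))
    (hXsol : IsSolution μ ζ K A X)
    (hX'norm : ‖X'‖ ≤ d₀ * (1 - v) / 2 -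
      Real.sqrt (d₀ ^ 2 * (1 - v) ^ 2 / 4 - d₀ * v * ‖A‖))
    (hX'sol : IsSolution μ (fun ω => (starRingEnd ℂ) (ζ ω))
      (fun ω => ContinuousLinearMap.adjoint (K ω)) A X')
    (lam : ℂ) (c : ℂ) (R : ℝ) (hR : 0 < R)
    (hball : Metric.closedBall c R ⊆
      {z : ℂ | Metric.infDist z (spectrum ℂ A) ≤ d₀ * (1 - v) / 2})
    (hlam : spectrum ℂ (A + X) ∩ Metric.closedBall c R = {lam})
    (hlam' : lam ∈ Metric.ball c R) :
    IsUnit ((1 : H →L[ℂ] H) +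
      OmegaOp μ ζ K (ContinuousLinearMap.adjoint (A + X')) (A + X)) ∧
    (-(1 / (2 * (Real.pi : ℂ) * Complex.I))) •
        (∮ z in C(c, R), Ring.inverse (Mtr μ ζ K A z)) =
      ((-(1 / (2 * (Real.pi : ℂ) * Complex.I))) •
          (∮ z in C(c, R),
            Ring.inverse (A + X - z • (1 : H →L[ℂ] H)))) ∘L
        Ring.inverse ((1 : H →L[ℂ] H) +
          OmegaOp μ ζ K (ContinuousLinearMap.adjoint (A + X')) (A + X)) ∧
    (-(1 / (2 * (Real.pi : ℂ) * Complex.I))) •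
        (∮ z in C(c, R), Ring.inverse (Mtr μ ζ K A z)) =
      Ring.inverse ((1 : H →L[ℂ] H) +
          OmegaOp μ ζ K (ContinuousLinearMap.adjoint (A + X')) (A + X)) ∘L
        ((-(1 / (2 * (Real.pi : ℂ) * Complex.I))) •
          (∮ z in C(c, R),
            Ring.inverse (ContinuousLinearMap.adjoint (A + X') -
              z • (1 : H →L[ℂ] H)))) := by
  obtain ⟨hXu, hXi, hXe⟩ := hXsol
  obtain ⟨hX'u, hX'i, hX'e⟩ := hX'sol
  have hlamS : lam ∈ spectrum ℂ (A + X) := by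
    have : lam ∈ spectrum ℂ (A + X) ∩ Metric.closedBall c R := by rw [hlam]; rfl
    exact this.1
  have hnt : Nontrivial (H →L[ℂ] H) := by
    by_contra hcon
    rw [not_nontrivial_iff_subsingleton] at hcon
    rw [spectrum.of_subsingleton] at hlamS
    exact hlamS
  have hntH : Nontrivial H := by
    by_contra hcon
    rw [not_nontrivial_iff_subsingleton] at hcon
    exact not_subsingleton (H →L[ℂ] H) inferInstance
  have hv0 : 0 ≤ v := by
    rw [hv]
    exact integral_nonneg fun ω => div_nonneg (norm_nonneg _) Metric.infDist_nonneg
  set s := d₀ * (1 - v) / 2 with hs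
  have hXs : ‖X‖ ≤ s := hXnorm.trans (sub_le_self _ (Real.sqrt_nonneg _))
  have hX's : ‖star X'‖ ≤ s := by
    rw [norm_star]
    exact hX'norm.trans (sub_le_self _ (Real.sqrt_nonneg _))
  set T : H →L[ℂ] H := ContinuousLinearMap.adjoint (A + X') with hTdef
  have hTstar : T = star (A + X') := rfl
  have hTA : T = A + star X' := by rw [hTstar, star_add, hA.star_eq]
  have hstarT : ∀ w : ℂ, T - w • (1 : H →L[ℂ] H) =
      star (A + X' - (starRingEnd ℂ) w • (1 : H →L[ℂ] H)) := by
    intro w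
    rw [star_sub, star_smul, star_one, ← hTstar]
    simp
  have hTu : ∀ᵐ ω ∂μ, IsUnit (T - ζ ω • (1 : H →L[ℂ] H)) := by
    filter_upwards [hX'u] with ω hω
    rw [hstarT]
    exact hω.star
  -- pointwise bounds
  have hbd : ∀ᵐ ω ∂μ, d₀ ≤ Metric.infDist (ζ ω) (spectrum ℂ A) ∧
      ‖ζ ω‖ ≤ (1 + ‖A‖ / d₀) * Metric.infDist (ζ ω) (spectrum ℂ A) ∧
      ‖Ring.inverse (T - ζ ω • (1 : H →L[ℂ] H))‖ ≤
        2 / ((1 + v) * Metric.infDist (ζ ω) (spectrum ℂ A)) ∧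
      ‖Ring.inverse (A + X - ζ ω • (1 : H →L[ℂ] H))‖ ≤
        2 / ((1 + v) * Metric.infDist (ζ ω) (spectrum ℂ A)) ∧
      ∀ z ∈ Metric.closedBall c R,
        (1 + v) * Metric.infDist (ζ ω) (spectrum ℂ A) / 2 ≤ ‖z - ζ ω‖ := by
    filter_upwards [hdist, hTu, hXu] with ω h1 h2 h3
    set d := Metric.infDist (ζ ω) (spectrum ℂ A) with hd
    have hd0 : 0 < d := lt_of_lt_of_le hd₀ h1
    have hds : (1 + v) * d / 2 ≤ d - s := by
      rw [hs]
      have : d₀ * (1 - v) ≤ d * (1 - v) := mul_le_mul_of_nonneg_right h1 (by linarith)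
      linarith
    have hpos : 0 < (1 + v) * d / 2 := by positivity
    have hbound : ∀ r : ℝ, r ≤ 1 / (d - s) → r ≤ 2 / ((1 + v) * d) := by
      intro r hr
      refine hr.trans ((one_div_le_one_div_of_le hpos hds).trans (le_of_eq ?_))
      rw [one_div_div]
    obtain ⟨b, hb1, hb2⟩ := selfadjoint_resolvent A hA (ζ ω) hd0
    refine ⟨h1, ?_, ?_, ?_, ?_⟩
    · obtain ⟨y, hy, hy2⟩ := (spectrum.isCompact A).exists_infDist_eq_dist ⟨_, (spectrum.nonempty A).some_mem⟩ (ζ ω)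
      have h4 : ‖y‖ ≤ ‖A‖ := spectrum.norm_le_norm_of_mem hy
      have h5 : ‖ζ ω‖ ≤ d + ‖A‖ := by
        rw [hd, hy2, dist_eq_norm]
        calc ‖ζ ω‖ = ‖(ζ ω - y) + y‖ := by rw [sub_add_cancel]
          _ ≤ ‖ζ ω - y‖ + ‖y‖ := norm_add_le _ _
          _ ≤ _ := by gcongr
      have h6 : ‖A‖ ≤ ‖A‖ / d₀ * d := by
        rw [div_mul_eq_mul_div, le_div_iff₀ hd₀]
        gcongr
      linarith
    · apply hbound
      have e : T - ζ ω • (1 : H →L[ℂ] H) = (A - ζ ω • (1 : H →L[ℂ] H)) + star X' := by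
        rw [hTA]; abel
      rw [e] at h2 ⊢
      exact inverse_bound hd0 hb1 hb2 (by linarith) hX's h2
    · apply hbound
      have e : A + X - ζ ω • (1 : H →L[ℂ] H) = (A - ζ ω • (1 : H →L[ℂ] H)) + X := by abel
      rw [e] at h3 ⊢
      exact inverse_bound hd0 hb1 hb2 (by linarith) hXs h3
    · intro z hz
      have h4 : Metric.infDist z (spectrum ℂ A) ≤ s := hball hz
      have h5 : d ≤ Metric.infDist z (spectrum ℂ A) + dist (ζ ω) z :=
        Metric.infDist_le_infDist_add_dist
      rw [dist_comm, dist_eq_norm] at h5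
      linarith
  have hmT := aesm_inverse hζ T hTu
  have hmS := aesm_inverse hζ (A + X) hXu
  have hmK := hK.aestronglyMeasurable
  have hmζ : AEStronglyMeasurable ζ μ := hζ.aestronglyMeasurable
  have ha0 : 0 ≤ ‖A‖ / d₀ := by positivity
  set a := ‖A‖ / d₀ with ha
  have hG : Integrable (fun ω => ζ ω • (Ring.inverse (T - ζ ω • (1 : H →L[ℂ] H)) * K ω)) μ := by
    refine Integrable.mono' (hK.norm.const_mul ((1 + a) * (2 / (1 + v))))
      (hmζ.smul (hmT.mul hmK)) ?_
    filter_upwards [hbd] with ω ⟨h1, h2, h3, h4, _⟩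
    have hd0 := lt_of_lt_of_le hd₀ h1
    calc _ ≤ ‖ζ ω‖ * (‖Ring.inverse (T - ζ ω • (1 : H →L[ℂ] H))‖ * ‖K ω‖) := by
          rw [norm_smul]; gcongr; exact norm_mul_le _ _
      _ ≤ ((1 + a) * Metric.infDist (ζ ω) (spectrum ℂ A)) *
          (2 / ((1 + v) * Metric.infDist (ζ ω) (spectrum ℂ A)) * ‖K ω‖) := by gcongr
      _ = _ := by field_simp
  have hG' : Integrable
      (fun ω => ζ ω • (K ω * Ring.inverse (A + X - ζ ω • (1 : H →L[ℂ] H)))) μ := by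
    refine Integrable.mono' (hK.norm.const_mul ((1 + a) * (2 / (1 + v))))
      (hmζ.smul (hmK.mul hmS)) ?_
    filter_upwards [hbd] with ω ⟨h1, h2, h3, h4, _⟩
    have hd0 := lt_of_lt_of_le hd₀ h1
    calc _ ≤ ‖ζ ω‖ * (‖K ω‖ * ‖Ring.inverse (A + X - ζ ω • (1 : H →L[ℂ] H))‖) := by
          rw [norm_smul]; gcongr; exact norm_mul_le _ _
      _ ≤ ((1 + a) * Metric.infDist (ζ ω) (spectrum ℂ A)) *
          (‖K ω‖ * (2 / ((1 + v) * Metric.infDist (ζ ω) (spectrum ℂ A)))) := by gcongr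
      _ = _ := by field_simp
  set C := (1 + a) * (4 / (1 + v) ^ 2) with hC
  have hCv : C * v < 1 := by
    have h1 : v * a < (1 - v) ^ 2 / 4 := by
      rw [ha, ← mul_div_assoc, div_lt_iff₀ hd₀]
      linarith
    have h2 : C * v = 4 * (v + v * a) / (1 + v) ^ 2 := by rw [hC]; ring
    rw [h2, div_lt_one (by positivity)]
    nlinarith
  have hYb : ∀ᵐ ω ∂μ, ‖ζ ω • (Ring.inverse (T - ζ ω • (1 : H →L[ℂ] H)) *
      (K ω * Ring.inverse (A + X - ζ ω • (1 : H →L[ℂ] H))))‖ ≤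
      C * (‖K ω‖ / Metric.infDist (ζ ω) (spectrum ℂ A)) := by
    filter_upwards [hbd] with ω ⟨h1, h2, h3, h4, _⟩
    have hd0 := lt_of_lt_of_le hd₀ h1
    calc _ ≤ ‖ζ ω‖ * (‖Ring.inverse (T - ζ ω • (1 : H →L[ℂ] H))‖ *
            (‖K ω‖ * ‖Ring.inverse (A + X - ζ ω • (1 : H →L[ℂ] H))‖)) := by
          rw [norm_smul]
          gcongr
          refine (norm_mul_le _ _).trans ?_
          gcongr
          exact norm_mul_le _ _
      _ ≤ ((1 + a) * Metric.infDist (ζ ω) (spectrum ℂ A)) *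
          (2 / ((1 + v) * Metric.infDist (ζ ω) (spectrum ℂ A)) *
          (‖K ω‖ * (2 / ((1 + v) * Metric.infDist (ζ ω) (spectrum ℂ A))))) := by gcongr
      _ = _ := by rw [hC]; field_simp; try ring
  have hY : Integrable (fun ω => ζ ω • (Ring.inverse (T - ζ ω • (1 : H →L[ℂ] H)) *
      (K ω * Ring.inverse (A + X - ζ ω • (1 : H →L[ℂ] H))))) μ :=
    Integrable.mono' (hvInt.const_mul C) (hmζ.smul (hmT.mul (hmK.mul hmS))) hYb
  have hCint : ∫ ω, C * (‖K ω‖ / Metric.infDist (ζ ω) (spectrum ℂ A)) ∂μ = C * v := by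
    rw [integral_const_mul, ← hv]
  have hunit : ∀ B : H →L[ℂ] H, ‖B‖ < 1 → IsUnit (1 + B) := by
    intro B hB
    have := isUnit_one_sub_of_norm_lt_one (x := -B) (by rwa [norm_neg])
    rwa [sub_neg_eq_add] at this
  have hOu : IsUnit ((1 : H →L[ℂ] H) + OmegaOp μ ζ K T (A + X)) := by
    apply hunit
    refine lt_of_le_of_lt (norm_integral_le_of_norm_le (hvInt.const_mul C) hYb) ?_
    rw [hCint]; exact hCv
  have hWu : ∀ z ∈ Metric.closedBall c R, IsUnit ((1 : H →L[ℂ] H) +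
      ∫ ω, (z - ζ ω)⁻¹ • ζ ω • (Ring.inverse (T - ζ ω • (1 : H →L[ℂ] H)) * K ω) ∂μ) := by
    intro z hz
    apply hunit
    refine lt_of_le_of_lt (norm_integral_le_of_norm_le (hvInt.const_mul C) ?_)
      (by rw [hCint]; exact hCv)
    filter_upwards [hbd] with ω ⟨h1, h2, h3, h4, h5⟩
    have hd0 := lt_of_lt_of_le hd₀ h1
    have h6 := h5 z hz
    have h7 : ‖(z - ζ ω)⁻¹‖ ≤ 2 / ((1 + v) * Metric.infDist (ζ ω) (spectrum ℂ A)) := by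
      rw [norm_inv, ← one_div]
      refine (one_div_le_one_div_of_le (by positivity) h6).trans (le_of_eq ?_)
      rw [one_div_div]
    calc _ ≤ ‖(z - ζ ω)⁻¹‖ *
          (‖ζ ω‖ * (‖Ring.inverse (T - ζ ω • (1 : H →L[ℂ] H))‖ * ‖K ω‖)) := by
          rw [norm_smul, norm_smul]; gcongr; exact norm_mul_le _ _
      _ ≤ (2 / ((1 + v) * Metric.infDist (ζ ω) (spectrum ℂ A))) *
          (((1 + a) * Metric.infDist (ζ ω) (spectrum ℂ A)) *
          (2 / ((1 + v) * Metric.infDist (ζ ω) (spectrum ℂ A)) * ‖K ω‖)) := by gcongr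
      _ = _ := by rw [hC]; field_simp; try ring
  have hsph : ∀ z ∈ Metric.sphere c R, IsUnit (A + X - z • (1 : H →L[ℂ] H)) := by
    intro z hz
    have hzs : z ∉ spectrum ℂ (A + X) := by
      intro hz2
      have h3 : z ∈ spectrum ℂ (A + X) ∩ Metric.closedBall c R :=
        ⟨hz2, Metric.sphere_subset_closedBall hz⟩
      rw [hlam, Set.mem_singleton_iff] at h3
      rw [h3, Metric.mem_sphere] at hz
      rw [Metric.mem_ball] at hlam'
      linarith
    rw [spectrum.notMem_iff, Algebra.algebraMap_eq_smul_one] at hzs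
    rw [← neg_sub]
    exact hzs.neg
  have hSeq : A + X = A + ∫ ω, K ω + ζ ω •
      (K ω * Ring.inverse (A + X - ζ ω • (1 : H →L[ℂ] H))) ∂μ := by
    congr 1
    refine hXe.trans (integral_congr_ae ?_)
    filter_upwards [hXu] with ω hω
    have a1 := Ring.mul_inverse_cancel _ hω
    set Rs := Ring.inverse (A + X - ζ ω • (1 : H →L[ℂ] H))
    have b1 : (A + X) * Rs = 1 + ζ ω • Rs := by
      rw [sub_mul, smul_mul_assoc, one_mul] at a1
      rw [← a1]; abel
    change K ω * ((A + X) * Rs) = _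
    rw [b1, mul_add, mul_one, mul_smul_comm]
  have hTeq : T = A + ∫ ω, K ω + ζ ω •
      (Ring.inverse (T - ζ ω • (1 : H →L[ℂ] H)) * K ω) ∂μ := by
    have e0 : star X' = ∫ ω, star (adjoint (K ω) ∘L ((A + X') ∘L
        Ring.inverse (A + X' - (starRingEnd ℂ) (ζ ω) • (1 : H →L[ℂ] H)))) ∂μ := by
      have := ((starL' ℝ : (H →L[ℂ] H) ≃L[ℝ] (H →L[ℂ] H)) :
        (H →L[ℂ] H) →L[ℝ] (H →L[ℂ] H)).integral_comp_comm hX'i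
      rw [← hX'e] at this
      exact this.symm
    have e1 : star X' = ∫ ω, K ω + ζ ω •
      (Ring.inverse (T - ζ ω • (1 : H →L[ℂ] H)) * K ω) ∂μ := by
      refine e0.trans (integral_congr_ae ?_)
      filter_upwards [hTu] with ω hω
      have e2 : star (adjoint (K ω) ∘L ((A + X') ∘L
          Ring.inverse (A + X' - (starRingEnd ℂ) (ζ ω) • (1 : H →L[ℂ] H)))) =
          Ring.inverse (T - ζ ω • (1 : H →L[ℂ] H)) * T * K ω := by
        change star (star (K ω) * ((A + X') *
          Ring.inverse (A + X' - (starRingEnd ℂ) (ζ ω) • (1 : H →L[ℂ] H)))) = _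
        rw [star_mul, star_mul, star_star, ← Ring.inverse_star, ← hstarT, ← hTstar]
      have a1 := Ring.inverse_mul_cancel _ hω
      rw [e2]
      set Rt := Ring.inverse (T - ζ ω • (1 : H →L[ℂ] H))
      have b1 : Rt * T = 1 + ζ ω • Rt := by
        rw [mul_sub, mul_smul_comm, mul_one] at a1
        rw [← a1]; abel
      rw [b1, add_mul, one_mul, smul_mul_assoc]
    rw [← e1, ← hTA]
  have hδz : ∀ z ∈ Metric.closedBall c R, ∀ᵐ ω ∂μ, (1 + v) * d₀ / 2 ≤ ‖z - ζ ω‖ := by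
    intro z hz
    filter_upwards [hbd] with ω ⟨h1, _, _, _, h5⟩
    refine le_trans ?_ (h5 z hz)
    gcongr
  obtain ⟨r1, r2⟩ := core_residue ζ hζ K hK A T (A + X) hTu hXu hG hG' hY hTeq hSeq
    (OmegaOp μ ζ K T (A + X)) rfl hOu c R hR ((1 + v) * d₀ / 2) (by positivity) hδz hWu hsph
  refine ⟨hOu, ?_, ?_⟩
  · refine (congrArg (fun y => (-(1 / (2 * (Real.pi : ℂ) * Complex.I))) • y) r1).trans ?_
    exact (smul_mul_assoc _ _ _).symm
  · refine (congrArg (fun y => (-(1 / (2 * (Real.pi : ℂ) * Complex.I))) • y) r2).trans ?_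
    exact (mul_smul_comm _ _ _).symm
end
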